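/- arXiv:2411.15639 — 9 statements merged into one kernel-verified Lean document; each statement's English description precedes it below -/
import Mathlib

section
/- Let r ≥ 1 and let H be a subgroup of ℤʳ. Then H has infinite index in ℤʳ if and only if there exists a nonzero additive group homomorphism f : ℤʳ → ℤ such that H ≤ ker(f). -/
theorem stmt6 (r : ℕ) (hr : 1 ≤ r) (H : AddSubgroup (Fin r → ℤ)) :
    H.index = 0 ↔
      ∃ f : (Fin r → ℤ) →+ ℤ, (∃ v : Fin r → ℤ, f v ≠ 0) ∧ H ≤ f.ker := by
  constructor
  · intro h
    by_contra hne
    push Not at hne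
    let S : Submodule ℤ (Fin r → ℤ) := AddSubgroup.toIntSubmodule H
    let Q := (Fin r → ℤ) ⧸ S
    have ht : Module.IsTorsion ℤ Q := by
      intro x
      suffices hx : x ∈ Submodule.torsion ℤ Q from (Submodule.mem_torsion_iff x).mp hx
      obtain ⟨v, rfl⟩ := Submodule.Quotient.mk_surjective S x
      rw [← Submodule.Quotient.mk_eq_zero]
      rw [← Module.forall_dual_apply_eq_zero_iff ℤ]
      intro φ
      by_contra hφ
      refine hne ((φ ∘ₗ (Submodule.torsion ℤ Q).mkQ ∘ₗ S.mkQ).toAddMonoidHom) ⟨v, hφ⟩ ?_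
      intro w hw
      have : S.mkQ w = 0 := by
        rw [Submodule.mkQ_apply, Submodule.Quotient.mk_eq_zero]
        exact hw
      change φ ((Submodule.torsion ℤ Q).mkQ (S.mkQ w)) = 0
      rw [this, map_zero, map_zero]
    have hfin : Finite Q := Module.finite_of_fg_torsion Q ht
    have hfin' : Finite ((Fin r → ℤ) ⧸ H) := hfin
    exact (AddSubgroup.finiteIndex_iff.mp (AddSubgroup.finiteIndex_iff_finite_quotient.mpr hfin')) h
  · rintro ⟨f, ⟨v, hv⟩, hH⟩
    by_contra hi
    have h1 : f (H.index • v) = 0 := hH (H.nsmul_index_mem v)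
    rw [map_nsmul, smul_eq_zero] at h1
    tauto
end

section
/- Let G be a finitely generated nilpotent group that admits a nonzero homomorphism onto a nontrivial subgroup of ℤ (equivalently, G has infinite abelianization), and let S ⊆ G. Then the following are equivalent: (i) for every nonzero homomorphism φ : G → ℝ there exists s ∈ S with φ(s) < 0; (ii) the subsemigroup S⁺ is a finite-index subgroup of G, i.e., there exists a subgroup H of G of finite index whose underlying set equals S⁺. -/
open scoped commutatorElement

theorem aux_total {A : Type*} [CommGroup A] (N : Submonoid A) (a : A)
    (ha : ∀ k : ℕ, 0 < k → a ^ k ∉ N) :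
    ∃ P : Submonoid A, N ≤ P ∧ (∀ k : ℕ, 0 < k → a ^ k ∉ P) ∧ ∀ x, x ∈ P ∨ x⁻¹ ∈ P := by
  obtain ⟨P, hNP, hP, hmax⟩ := zorn_le_nonempty₀
    {P : Submonoid A | ∀ k : ℕ, 0 < k → a ^ k ∉ P} (by
      intro c hc hch y hy
      refine ⟨sSup c, ?_, fun z hz => le_sSup hz⟩
      intro k hk hmem
      rw [Submonoid.mem_sSup_of_directedOn ⟨y, hy⟩ hch.directedOn] at hmem
      obtain ⟨s, hs, h⟩ := hmem
      exact hc hs k hk h) N ha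
  refine ⟨P, hNP, hP, ?_⟩
  have key : ∀ x, x ∉ P → ∃ k : ℕ, 0 < k ∧ ∃ p ∈ P, ∃ i : ℕ, a ^ k = p * x ^ i := by
    intro x hx
    by_contra hcon
    push Not at hcon
    have h1 : P ⊔ Submonoid.powers x ∈ {P : Submonoid A | ∀ k : ℕ, 0 < k → a ^ k ∉ P} := by
      intro k hk hmem
      rw [Submonoid.mem_sup] at hmem
      obtain ⟨p, hp, z, ⟨i, rfl⟩, h⟩ := hmem
      exact hcon k hk p hp i h.symm
    have h2 := hmax h1 le_sup_left
    exact hx (h2 (Submonoid.mem_sup_right (Submonoid.mem_powers x)))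
  intro x
  by_contra hcon
  push Not at hcon
  obtain ⟨k, hk, p, hp, i, h⟩ := key x hcon.1
  obtain ⟨l, hl, q, hq, j, h'⟩ := key x⁻¹ hcon.2
  rcases Nat.eq_zero_or_pos i with rfl | hi
  · exact hP k hk (by rw [h]; simpa using hp)
  apply hP (k * j + l * i) (by positivity)
  have : a ^ (k * j + l * i) = p ^ j * q ^ i := by
    rw [pow_add, pow_mul, pow_mul, h, h', mul_pow, mul_pow, ← pow_mul, ← pow_mul, inv_pow,
      mul_comm j i]
    rw [mul_mul_mul_comm]; simp
  rw [this]
  exact mul_mem (pow_mem hp _) (pow_mem hq _)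

theorem aux_unit {A : Type*} [CommGroup A] [Group.FG A] (P : Submonoid A) (a : A)
    (ha : ∀ k : ℕ, 0 < k → a ^ k ∉ P) (ht : ∀ x, x ∈ P ∨ x⁻¹ ∈ P) :
    ∃ u ∈ P, (∀ k : ℕ, 0 < k → (u ^ k)⁻¹ ∉ P) ∧ ∀ x, ∃ m : ℕ, u ^ m * x ∈ P := by
  classical
  have key : ∀ T : Finset A, ∃ u ∈ P, ∀ t ∈ T, u * t ∈ P ∧ u * t⁻¹ ∈ P := by
    intro T
    induction T using Finset.induction_on with
    | empty => exact ⟨1, one_mem _, by simp⟩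
    | insert x T hx ih =>
      obtain ⟨u, hu, h⟩ := ih
      have : ∃ v ∈ P, v * x ∈ P ∧ v * x⁻¹ ∈ P := by
        rcases ht x with h | h
        · exact ⟨x, h, mul_mem h h, by simp⟩
        · exact ⟨x⁻¹, h, by simp, mul_mem h h⟩
      obtain ⟨v, hv, hv1, hv2⟩ := this
      refine ⟨u * v, mul_mem hu hv, ?_⟩
      intro t htT
      rcases Finset.mem_insert.1 htT with rfl | h'
      · exact ⟨by rw [mul_assoc]; exact mul_mem hu hv1, by rw [mul_assoc]; exact mul_mem hu hv2⟩
      · exact ⟨by rw [mul_comm u v, mul_assoc]; exact mul_mem hv (h t h').1,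
          by rw [mul_comm u v, mul_assoc]; exact mul_mem hv (h t h').2⟩
  obtain ⟨T, hT⟩ := (Group.FG.out : (⊤ : Subgroup A).FG)
  obtain ⟨u, hu, h⟩ := key (insert a T)
  refine ⟨u, hu, ?_, ?_⟩
  · intro k hk hmem
    apply ha k hk
    have : a ^ k = (u * a) ^ k * (u ^ k)⁻¹ := by rw [mul_pow]; simp
    rw [this]
    exact mul_mem (pow_mem (h a (Finset.mem_insert_self _ _)).1 _) hmem
  · have : ∀ x ∈ Subgroup.closure (T : Set A), ∃ m : ℕ, u ^ m * x ∈ P ∧ u ^ m * x⁻¹ ∈ P := by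
      intro x hx
      induction hx using Subgroup.closure_induction with
      | mem x hx => exact ⟨1, by simpa using h x (Finset.mem_insert_of_mem hx)⟩
      | one => exact ⟨0, by simp⟩
      | mul x y _ _ hx hy =>
        obtain ⟨m, h1, h2⟩ := hx
        obtain ⟨n, h3, h4⟩ := hy
        refine ⟨m + n, ?_, ?_⟩
        · rw [pow_add, mul_mul_mul_comm]; exact mul_mem h1 h3
        · rw [pow_add, mul_inv, mul_mul_mul_comm]; exact mul_mem h2 h4
      | inv x _ hx =>
        obtain ⟨m, h1, h2⟩ := hx
        exact ⟨m, h2, by simpa using h1⟩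
    intro x
    obtain ⟨m, hm, _⟩ := this x (by rw [hT]; trivial)
    exact ⟨m, hm⟩

theorem aux_state {A : Type*} [CommGroup A] (P : Submonoid A) (u : A)
    (hk : ∀ k : ℕ, 0 < k → (u ^ k)⁻¹ ∉ P) (hm : ∀ x, ∃ m : ℕ, u ^ m * x ∈ P)
    (ht : ∀ x, x ∈ P ∨ x⁻¹ ∈ P) :
    ∃ φ : A → ℝ, (∀ a b, φ (a * b) = φ a + φ b) ∧ (∀ x ∈ P, 0 ≤ φ x) ∧ φ u ≠ 0 := by
  let D : A → Set ℝ := fun x => {r | ∃ n : ℕ, 0 < n ∧ ∃ m : ℤ, r = m / n ∧ x ^ n * u ^ (-m) ∈ P}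
  have hadd : ∀ x y r s, r ∈ D x → s ∈ D y → r + s ∈ D (x * y) := by
    rintro x y r s ⟨n, hn, m, rfl, h⟩ ⟨n', hn', m', rfl, h'⟩
    refine ⟨n * n', by positivity, m * n' + m' * n, ?_, ?_⟩
    · have : (n : ℝ) ≠ 0 := by positivity
      have : (n' : ℝ) ≠ 0 := by positivity
      push_cast; field_simp
    · have : (x * y) ^ (n * n') * u ^ (-(m * n' + m' * n)) =
          (x ^ n * u ^ (-m)) ^ n' * (y ^ n' * u ^ (-m')) ^ n := by
        rw [mul_pow, mul_pow, mul_pow, ← zpow_natCast (u ^ (-m)), ← zpow_natCast (u ^ (-m')),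
          ← zpow_mul, ← zpow_mul, ← pow_mul, ← pow_mul, mul_mul_mul_comm (x ^ _), ← zpow_add,
          mul_comm n' n]
        congr 2; ring
      rw [this]
      exact mul_mem (pow_mem h _) (pow_mem h' _)
  have htot : ∀ x (q : ℚ), (q : ℝ) ∈ D x ∨ -(q : ℝ) ∈ D x⁻¹ := by
    intro x q
    have e : (q : ℝ) = q.num / q.den := by exact_mod_cast (Rat.num_div_den q).symm
    rcases ht (x ^ q.den * u ^ (-q.num)) with h | h
    · exact Or.inl ⟨q.den, q.den_pos, q.num, e, h⟩
    · refine Or.inr ⟨q.den, q.den_pos, -q.num, by rw [e]; push_cast; ring, ?_⟩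
      have : x⁻¹ ^ q.den * u ^ (- -q.num) = (x ^ q.den * u ^ (-q.num))⁻¹ := by
        rw [mul_inv, inv_pow, ← zpow_neg]
      rw [this]; exact h
  have hone : ∀ r ∈ D 1, r ≤ 0 := by
    rintro r ⟨n, hn, m, rfl, h⟩
    by_contra hcon
    have hm0 : 0 < m := by
      by_contra h0
      push Not at h0
      exact hcon (div_nonpos_of_nonpos_of_nonneg (by exact_mod_cast h0) (by positivity))
    lift m to ℕ using hm0.le
    apply hk m (by exact_mod_cast hm0)
    simpa using h
  have hinv : ∀ x r s, r ∈ D x → s ∈ D x⁻¹ → r + s ≤ 0 := by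
    intro x r s hr hs
    have := hadd _ _ _ _ hr hs
    rw [mul_inv_cancel] at this
    exact hone _ this
  have hne : ∀ x, (D x).Nonempty := by
    intro x
    obtain ⟨m, h⟩ := hm x
    exact ⟨_, 1, one_pos, -m, rfl, by simpa [mul_comm] using h⟩
  have hbdd : ∀ x, BddAbove (D x) := by
    intro x
    obtain ⟨s, hs⟩ := hne x⁻¹
    exact ⟨-s, fun r hr => by linarith [hinv x r s hr hs]⟩
  have hpos : ∀ x ∈ P, 0 ≤ sSup (D x) := fun x hx =>
    le_csSup (hbdd x) ⟨1, one_pos, 0, by simp, by simpa using hx⟩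
  have hsup : ∀ x y, sSup (D x) + sSup (D y) ≤ sSup (D (x * y)) := by
    intro x y
    have h1 : sSup (D x) ≤ sSup (D (x * y)) - sSup (D y) := by
      refine csSup_le (hne x) fun r hr => ?_
      have : sSup (D y) ≤ sSup (D (x * y)) - r := by
        refine csSup_le (hne y) fun s hs => ?_
        have := le_csSup (hbdd (x * y)) (hadd _ _ _ _ hr hs)
        linarith
      linarith
    linarith
  have h1 : sSup (D 1) ≤ 0 := csSup_le (hne 1) hone
  have hneg : ∀ x, sSup (D x⁻¹) = - sSup (D x) := by
    intro x
    apply le_antisymm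
    · have := hsup x x⁻¹
      rw [mul_inv_cancel] at this
      linarith
    · by_contra hcon
      push Not at hcon
      obtain ⟨q, hq1, hq2⟩ := exists_rat_btwn hcon
      rcases htot x (-q) with h | h
      · have := le_csSup (hbdd x) h
        push_cast at this
        linarith
      · have := le_csSup (hbdd x⁻¹) h
        push_cast at this
        linarith
  refine ⟨fun x => sSup (D x), fun x y => le_antisymm ?_ (hsup x y), hpos, ?_⟩
  · have := hsup (x * y) y⁻¹
    rw [mul_inv_cancel_right, hneg] at this
    show sSup (D (x * y)) ≤ sSup (D x) + sSup (D y)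
    linarith
  · have : (1 : ℝ) ≤ sSup (D u) := le_csSup (hbdd u) ⟨1, one_pos, 1, by simp, by simp⟩
    show sSup (D u) ≠ 0
    linarith

theorem lemA {A : Type*} [CommGroup A] [Group.FG A] (N : Submonoid A)
    (h : ∀ φ : A → ℝ, (∀ a b, φ (a * b) = φ a + φ b) → (∀ x ∈ N, 0 ≤ φ x) → ∀ x, φ x = 0)
    (a : A) : ∃ k : ℕ, 0 < k ∧ a ^ k ∈ N := by
  by_contra hcon
  push Not at hcon
  obtain ⟨P, hNP, hP, ht⟩ := aux_total N a hcon
  obtain ⟨u, hu, hk, hm⟩ := aux_unit P a hP ht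
  obtain ⟨φ, h1, h2, h3⟩ := aux_state P u hk hm ht
  exact h3 (h φ h1 (fun x hx => h2 x (hNP hx)) u)

theorem cm_left {Q : Type*} [Group Q] (a b y : Q) (h : ⁅b, y⁆ ∈ Subgroup.center Q) :
    ⁅a * b, y⁆ = ⁅a, y⁆ * ⁅b, y⁆ := by
  have h1 : a * ⁅b, y⁆ = ⁅b, y⁆ * a := Subgroup.mem_center_iff.1 h a
  have h2 := Subgroup.mem_center_iff.1 h (a * y * a⁻¹ * y⁻¹)
  have : ⁅a * b, y⁆ = a * ⁅b, y⁆ * (y * a⁻¹ * y⁻¹) := by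
    simp only [commutatorElement_def]; group
  rw [this, h1, commutatorElement_def a y, h2]
  simp only [mul_assoc]

theorem cm_right {Q : Type*} [Group Q] (a b y : Q) (h : ⁅y, b⁆ ∈ Subgroup.center Q) :
    ⁅y, a * b⁆ = ⁅y, a⁆ * ⁅y, b⁆ := by
  have h' : ⁅b, y⁆ ∈ Subgroup.center Q := by
    rw [← commutatorElement_inv]; exact inv_mem h
  rw [← commutatorElement_inv, cm_left a b y h', mul_inv_rev, commutatorElement_inv,
    commutatorElement_inv, ← Subgroup.mem_center_iff.1 h]

theorem cm_pow {Q : Type*} [Group Q] (x y : Q) (h : ⁅x, y⁆ ∈ Subgroup.center Q) (n m : ℕ) :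
    ⁅x ^ n, y ^ m⁆ = ⁅x, y⁆ ^ (n * m) := by
  have h1 : ∀ n : ℕ, ⁅x ^ n, y⁆ = ⁅x, y⁆ ^ n := by
    intro n
    induction n with
    | zero => simp
    | succ n ih => rw [pow_succ, cm_left _ _ _ h, ih, pow_succ]
  have h2 : ⁅x ^ n, y⁆ ∈ Subgroup.center Q := by rw [h1]; exact pow_mem h n
  have h3 : ∀ m : ℕ, ⁅x ^ n, y ^ m⁆ = ⁅x ^ n, y⁆ ^ m := by
    intro m
    induction m with
    | zero => simp
    | succ m ih => rw [pow_succ, cm_right _ _ _ h2, ih, pow_succ]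
  rw [h3, h1, pow_mul]

theorem cm_rearrange {Q : Type*} [Group Q] (X Y p q r s : Q) (hp : p ∈ Subgroup.center Q)
    (hq : q ∈ Subgroup.center Q) (hr : r ∈ Subgroup.center Q) :
    (X * p) * (Y * q) * (X⁻¹ * r) * (Y⁻¹ * s) = ⁅X, Y⁆ * (p * q * r * s) := by
  have e1 := Subgroup.mem_center_iff.1 hp
  have e2 := Subgroup.mem_center_iff.1 hq
  have e3 := Subgroup.mem_center_iff.1 hr
  calc (X * p) * (Y * q) * (X⁻¹ * r) * (Y⁻¹ * s)
      = X * (p * (Y * (q * (X⁻¹ * (r * Y⁻¹))))) * s := by simp only [mul_assoc]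
    _ = ⁅X, Y⁆ * (p * q * r * s) := by
        rw [← e3, ← mul_assoc X⁻¹, ← e2, ← mul_assoc Y, ← e1, commutatorElement_def]
        have := e1 r
        have := e1 q
        have h4 := e2 r
        simp only [mul_assoc]
        congr 4
        rw [← mul_assoc, ← mul_assoc, ← mul_assoc, ← mul_assoc]
        congr 1
        rw [mul_assoc p q r, ← e1 (q * r), h4]

theorem phi_pow {A : Type*} [Group A] (φ : A → ℝ) (h : ∀ a b, φ (a * b) = φ a + φ b) (a : A)
    (k : ℕ) : φ (a ^ k) = k * φ a := by
  induction k with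
  | zero =>
    have := h 1 1
    simp at this
    simp [this]
  | succ k ih => rw [pow_succ, h, ih]; push_cast; ring

theorem lemB {Q : Type*} [Group Q] (Z : Subgroup Q) (hZ : Z ≤ Subgroup.center Q) (hfg : Z.FG)
    (C : Set Q) (hC : Z = Subgroup.closure C) (hCc : ∀ c ∈ C, ∃ x y : Q, c = ⁅x, y⁆)
    (M : Submonoid Q) (hM : ∀ g : Q, ∃ k : ℕ, 0 < k ∧ ∃ z ∈ Z, g ^ k * z ∈ M) (g : Q) :
    ∃ k : ℕ, 0 < k ∧ g ^ k ∈ M := by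
  have hcomm : ∀ (x z : Q) (n : ℕ), z ∈ Z → (x * z) ^ n = x ^ n * z ^ n := fun x z n hz =>
    Commute.mul_pow (Subgroup.mem_center_iff.1 (hZ hz) x) n
  let _ : CommGroup Z := { (inferInstance : Group Z) with
    mul_comm := fun a b => Subtype.ext (Subgroup.mem_center_iff.1 (hZ b.2) a) }
  have : Group.FG Z := (Group.fg_iff_subgroup_fg Z).2 hfg
  have hpm : ∀ x : Q, ∃ n : ℕ, 0 < n ∧ ∃ z ∈ Z, ∃ z' ∈ Z, x ^ n * z ∈ M ∧ (x ^ n)⁻¹ * z' ∈ M := by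
    intro x
    obtain ⟨a, ha, z, hz, h⟩ := hM x
    obtain ⟨b, hb, z', hz', h'⟩ := hM x⁻¹
    refine ⟨a * b, by positivity, z ^ b, pow_mem hz _, z' ^ a, pow_mem hz' _, ?_, ?_⟩
    · rw [pow_mul, ← hcomm _ _ _ hz]; exact pow_mem h _
    · rw [mul_comm a b, pow_mul, ← inv_pow, ← inv_pow, ← hcomm _ _ _ hz']; exact pow_mem h' _
  have hpm2 : ∀ x y : Q, ∃ n : ℕ, 0 < n ∧ ∃ z ∈ Z, ∃ z' ∈ Z, ∃ w ∈ Z, ∃ w' ∈ Z,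
      x ^ n * z ∈ M ∧ (x ^ n)⁻¹ * z' ∈ M ∧ y ^ n * w ∈ M ∧ (y ^ n)⁻¹ * w' ∈ M := by
    intro x y
    obtain ⟨a, ha, z, hz, z', hz', h, h'⟩ := hpm x
    obtain ⟨b, hb, w, hw, w', hw', k, k'⟩ := hpm y
    refine ⟨a * b, by positivity, z ^ b, pow_mem hz _, z' ^ b, pow_mem hz' _,
      w ^ a, pow_mem hw _, w' ^ a, pow_mem hw' _, ?_, ?_, ?_, ?_⟩
    · rw [pow_mul, ← hcomm _ _ _ hz]; exact pow_mem h _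
    · rw [pow_mul, ← inv_pow, ← hcomm _ _ _ hz']; exact pow_mem h' _
    · rw [mul_comm a b, pow_mul, ← hcomm _ _ _ hw]; exact pow_mem k _
    · rw [mul_comm a b, pow_mul, ← inv_pow, ← hcomm _ _ _ hw']; exact pow_mem k' _
  have hmain : ∀ φ : Z → ℝ, (∀ a b, φ (a * b) = φ a + φ b) →
      (∀ x ∈ M.comap Z.subtype, 0 ≤ φ x) → ∀ x, φ x = 0 := by
    intro φ hφ hpos
    have hge : ∀ (x y : Q) (hxy : ⁅x, y⁆ ∈ Z), 0 ≤ φ ⟨⁅x, y⁆, hxy⟩ := by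
      intro x y hxy
      obtain ⟨n, hn, z, hz, z', hz', w, hw, w', hw', h1, h2, h3, h4⟩ := hpm2 x y
      set c : Z := ⟨⁅x, y⁆, hxy⟩ with hc
      set t : Z := ⟨z, hz⟩ * ⟨w, hw⟩ * ⟨z', hz'⟩ * ⟨w', hw'⟩ with htdef
      have hk : ∀ k : ℕ, 0 ≤ ((n * k) * (n * k) : ℝ) * φ c + k * φ t := by
        intro k
        have hmem : c ^ ((n * k) * (n * k)) * t ^ k ∈ M.comap Z.subtype := by
          have e : ((c ^ ((n * k) * (n * k)) * t ^ k : Z) : Q) =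
              (x ^ n * z) ^ k * (y ^ n * w) ^ k * ((x ^ n)⁻¹ * z') ^ k * ((y ^ n)⁻¹ * w') ^ k := by
            rw [hcomm _ _ _ hz, hcomm _ _ _ hz', hcomm _ _ _ hw, hcomm _ _ _ hw', inv_pow, inv_pow,
              cm_rearrange _ _ _ _ _ _ (hZ (pow_mem hz _)) (hZ (pow_mem hw _))
                (hZ (pow_mem hz' _)), ← pow_mul, ← pow_mul, cm_pow _ _ (hZ hxy),
              htdef, mul_pow, mul_pow, mul_pow]
            rfl
          show ((c ^ ((n * k) * (n * k)) * t ^ k : Z) : Q) ∈ M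
          rw [e]
          exact mul_mem (mul_mem (mul_mem (pow_mem h1 _) (pow_mem h3 _)) (pow_mem h2 _))
            (pow_mem h4 _)
        have := hpos _ hmem
        rw [hφ, phi_pow φ hφ, phi_pow φ hφ] at this
        push_cast at this
        exact this
      by_contra hneg
      push Not at hneg
      obtain ⟨k, hkk⟩ := exists_nat_gt (|φ t| / (-φ c))
      rw [div_lt_iff₀ (by linarith)] at hkk
      have hk0 : (0 : ℝ) < k := by
        rcases Nat.eq_zero_or_pos k with rfl | h
        · simp at hkk
          exact absurd hkk (not_lt.2 (abs_nonneg _))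
        · exact_mod_cast h
      have h5 := hk k
      have h6 : (1 : ℝ) ≤ n := by exact_mod_cast hn
      have h7 : 0 ≤ ((n * n * k : ℝ)) * φ c + φ t := by
        by_contra h8
        push Not at h8
        have := mul_neg_of_pos_of_neg hk0 h8
        nlinarith
      have h8 : (1 : ℝ) ≤ n * n := by nlinarith
      have h9 : (k : ℝ) * (-φ c) ≤ (n * n) * (k * (-φ c)) :=
        le_mul_of_one_le_left (by nlinarith) h8
      have := le_abs_self (φ t)
      nlinarith
    have hinv : ∀ a, φ a⁻¹ = - φ a := by
      intro a
      have h1 := hφ a a⁻¹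
      have h2 := phi_pow φ hφ a 0
      simp at h1 h2
      linarith
    intro x
    have hz : ∀ q (hq : q ∈ Subgroup.closure C), φ ⟨q, hC ▸ hq⟩ = 0 := by
      intro q hq
      induction hq using Subgroup.closure_induction with
      | mem c hc =>
        obtain ⟨a, b, rfl⟩ := hCc c hc
        have hab : ⁅a, b⁆ ∈ Z := by rw [hC]; exact Subgroup.subset_closure hc
        have hba : ⁅b, a⁆ ∈ Z := by rw [← commutatorElement_inv]; exact inv_mem hab
        have h1 := hge a b hab
        have h2 := hge b a hba
        have h3 : (⟨⁅b, a⁆, hba⟩ : Z) = ⟨⁅a, b⁆, hab⟩⁻¹ :=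
          Subtype.ext (commutatorElement_inv a b).symm
        rw [h3, hinv] at h2
        linarith
      | one =>
        have h0 : φ 1 = 0 := by simpa using phi_pow φ hφ 1 0
        exact h0
      | mul a b ha hb h1 h2 =>
        have := hφ ⟨a, hC ▸ ha⟩ ⟨b, hC ▸ hb⟩
        rw [h1, h2, add_zero] at this
        exact this
      | inv a ha h1 =>
        have := hinv ⟨a, hC ▸ ha⟩
        rw [h1, neg_zero] at this
        exact this
    exact hz x.1 (hC ▸ x.2)
  obtain ⟨k, hk, z, hz, h⟩ := hM g
  obtain ⟨l, hl, h'⟩ := lemA _ hmain ⟨z, hz⟩⁻¹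
  refine ⟨k * l, by positivity, ?_⟩
  have h2 : (z⁻¹) ^ l ∈ M := h'
  have : g ^ (k * l) = (g ^ k * z) ^ l * z⁻¹ ^ l := by
    rw [hcomm _ _ _ hz, pow_mul]; simp
  rw [this]
  exact mul_mem (pow_mem h _) h2

theorem lcs_central {G : Type*} [Group G] (n : ℕ)
    (h : (⊤ : Subgroup G).lowerCentralSeries (n + 1) = ⊥) :
    (⊤ : Subgroup G).lowerCentralSeries n ≤ Subgroup.center G := by
  intro z hz
  rw [Subgroup.mem_center_iff]
  intro g
  have h1 : ⁅z, g⁆ ∈ (⊤ : Subgroup G).lowerCentralSeries (n + 1) :=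
    Subgroup.commutator_mem_commutator hz (Subgroup.mem_top g)
  rw [h, Subgroup.mem_bot, commutatorElement_eq_one_iff_mul_comm] at h1
  exact h1.symm

theorem lcs_quot {G : Type*} [Group G] (N : Subgroup G) [N.Normal] (k : ℕ) :
    (⊤ : Subgroup (G ⧸ N)).lowerCentralSeries k =
      ((⊤ : Subgroup G).lowerCentralSeries k).map (QuotientGroup.mk' N) := by
  rw [Subgroup.map_lowerCentralSeries,
    Subgroup.map_top_of_surjective _ (QuotientGroup.mk'_surjective N)]

theorem lcs_quot_bot {G : Type*} [Group G] (n : ℕ) :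
    (⊤ : Subgroup (G ⧸ (⊤ : Subgroup G).lowerCentralSeries n)).lowerCentralSeries n = ⊥ := by
  rw [lcs_quot]
  exact (Subgroup.map_eq_bot_iff _).2 (by simp)

theorem lcs_fg (n : ℕ) : ∀ {G : Type*} [Group G] [Group.FG G],
    (⊤ : Subgroup G).lowerCentralSeries (n + 1) = ⊥ →
    ((⊤ : Subgroup G).lowerCentralSeries n).FG := by
  induction n with
  | zero =>
    intro G _ _ _
    exact Group.FG.out
  | succ n ih =>
    intro G _ _ h
    have hZc := lcs_central _ h
    obtain ⟨X, hX⟩ := (Group.FG.out : (⊤ : Subgroup G).FG)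
    set Z := (⊤ : Subgroup G).lowerCentralSeries (n + 1) with hZ
    set K := (⊤ : Subgroup G).lowerCentralSeries n with hK
    have hKZ : ∀ a ∈ K, ∀ b : G, ⁅a, b⁆ ∈ Z := fun a ha b =>
      Subgroup.commutator_mem_commutator ha (Subgroup.mem_top b)
    obtain ⟨T, hT⟩ := ih (G := G ⧸ Z) (lcs_quot_bot (G := G) (n + 1))
    rw [lcs_quot, ← hK] at hT
    have hTK : (T : Set (G ⧸ Z)) ⊆ (QuotientGroup.mk' Z) '' (K : Set G) := by
      have : (T : Set (G ⧸ Z)) ⊆ ((K.map (QuotientGroup.mk' Z) : Subgroup (G ⧸ Z)) : Set (G ⧸ Z)) := by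
        rw [← hT]; exact Subgroup.subset_closure
      simpa using this
    obtain ⟨T', hT'K, hT'⟩ := Set.SurjOn.exists_bijOn_subset hTK
    have hT'f : T'.Finite := hT'.finite_iff_finite.2 T.finite_toSet
    have hcen : ∀ a ∈ K, ∀ b : G, ⁅a, b⁆ ∈ Subgroup.center G := fun a ha b => hZc (hKZ a ha b)
    set C : Set G := Set.image2 (fun a b => ⁅a, b⁆) T' (X : Set G) with hCdef
    have hCf : C.Finite := hT'f.image2 _ X.finite_toSet
    have s1 : ∀ t ∈ T', ∀ b : G, ⁅t, b⁆ ∈ Subgroup.closure C := by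
      intro t ht b
      have hb : b ∈ Subgroup.closure (X : Set G) := by rw [hX]; trivial
      induction hb using Subgroup.closure_induction with
      | mem b hb => exact Subgroup.subset_closure ⟨t, ht, b, hb, rfl⟩
      | one => rw [commutatorElement_one_right]; exact one_mem _
      | mul b c _ _ h1 h2 =>
        rw [cm_right _ _ _ (hcen t (hT'K ht) c)]; exact mul_mem h1 h2
      | inv b _ h1 =>
        have := cm_right b⁻¹ b t (hcen t (hT'K ht) b)
        rw [inv_mul_cancel, commutatorElement_one_right] at this
        rw [eq_inv_of_mul_eq_one_left this.symm]
        exact inv_mem h1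
    have hclK : Subgroup.closure T' ≤ K := (Subgroup.closure_le _).2 hT'K
    have s2 : ∀ a ∈ Subgroup.closure T', ∀ b : G, ⁅a, b⁆ ∈ Subgroup.closure C := by
      intro a ha b
      induction ha using Subgroup.closure_induction with
      | mem a ha => exact s1 a ha b
      | one => rw [commutatorElement_one_left]; exact one_mem _
      | mul a c _ hc h1 h2 =>
        rw [cm_left _ _ _ (hcen c (hclK hc) b)]; exact mul_mem h1 h2
      | inv a ha h1 =>
        have := cm_left a⁻¹ a b (hcen a (hclK ha) b)
        rw [inv_mul_cancel, commutatorElement_one_left] at this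
        rw [eq_inv_of_mul_eq_one_left this.symm]
        exact inv_mem h1
    have s3 : ∀ a ∈ K, ∀ b : G, ⁅a, b⁆ ∈ Subgroup.closure C := by
      intro a ha b
      have h1 : QuotientGroup.mk' Z a ∈ (Subgroup.closure T').map (QuotientGroup.mk' Z) := by
        rw [MonoidHom.map_closure, hT'.image_eq, hT]
        exact Subgroup.mem_map_of_mem _ ha
      obtain ⟨a', ha', he⟩ := h1
      have hz : a'⁻¹ * a ∈ Z := QuotientGroup.eq.1 he
      have h2 : ⁅a'⁻¹ * a, b⁆ = 1 :=
        commutatorElement_eq_one_iff_mul_comm.2 (Subgroup.mem_center_iff.1 (hZc hz) b).symm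
      have h3 := cm_left a' (a'⁻¹ * a) b (by rw [h2]; exact one_mem _)
      rw [h2, mul_one, mul_inv_cancel_left] at h3
      rw [h3]
      exact s2 a' ha' b
    refine (Subgroup.fg_iff _).2 ⟨C, le_antisymm ?_ ?_, hCf⟩
    · rw [Subgroup.closure_le]
      rintro _ ⟨t, ht, x, _, rfl⟩
      exact hKZ t (hT'K ht) x
    · exact Subgroup.commutator_le.2 fun a ha b _ => s3 a ha b

theorem lemT (n : ℕ) : ∀ {G : Type*} [Group G] [Group.FG G] (M : Submonoid G),
    (⊤ : Subgroup G).lowerCentralSeries n = ⊥ →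
    (∀ φ : G → ℝ, (∀ a b, φ (a * b) = φ a + φ b) → (∀ x ∈ M, 0 ≤ φ x) → ∀ x, φ x = 0) →
    ∀ g : G, ∃ k : ℕ, 0 < k ∧ g ^ k ∈ M := by
  induction n with
  | zero =>
    intro G _ _ M h _ g
    have hg : g ∈ (⊥ : Subgroup G) := by rw [← h]; trivial
    rw [Subgroup.mem_bot] at hg
    exact ⟨1, one_pos, by simp [hg]⟩
  | succ n ih =>
    intro G _ _ M h hφ
    have hc := lcs_central _ h
    rcases n with _ | m
    · let _ : CommGroup G := { (inferInstance : Group G) with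
        mul_comm := fun a b =>
          Subgroup.mem_center_iff.1 (hc (show b ∈ (⊤ : Subgroup G) from trivial)) a }
      exact lemA M hφ
    · set Z := (⊤ : Subgroup G).lowerCentralSeries (m + 1) with hZ
      have h1 := ih (G := G ⧸ Z) (M.map (QuotientGroup.mk' Z)) (lcs_quot_bot (m + 1)) (by
        intro φ ha hp x
        obtain ⟨x, rfl⟩ := QuotientGroup.mk'_surjective Z x
        exact hφ (fun g => φ (QuotientGroup.mk' Z g)) (fun a b => by simp [ha])
          (fun y hy => hp _ (Submonoid.mem_map_of_mem _ hy)) x)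
      refine lemB Z hc (lcs_fg _ h) {x | ∃ p ∈ (⊤ : Subgroup G).lowerCentralSeries m,
        ∃ q ∈ (⊤ : Subgroup G), ⁅p, q⁆ = x} rfl ?_ M ?_
      · rintro c ⟨p, _, q, _, rfl⟩
        exact ⟨p, q, rfl⟩
      · intro g
        obtain ⟨k, hk, y, hy, he⟩ := h1 (QuotientGroup.mk' Z g)
        refine ⟨k, hk, (g ^ k)⁻¹ * y, ?_, by simpa using hy⟩
        rw [← map_pow] at he
        exact QuotientGroup.eq.1 he.symm

theorem lemI (n : ℕ) : ∀ {G : Type*} [Group G] [Group.FG G] (H : Subgroup G),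
    (⊤ : Subgroup G).lowerCentralSeries n = ⊥ →
    (∀ g : G, ∃ k : ℕ, 0 < k ∧ g ^ k ∈ H) → H.index ≠ 0 := by
  induction n with
  | zero =>
    intro G _ _ H h _
    have : H = ⊤ := by
      rw [eq_top_iff]
      change (⊤ : Subgroup G) = ⊥ at h
      rw [h]; exact bot_le
    simp [this]
  | succ n ih =>
    intro G _ _ H h hp
    have hc := lcs_central _ h
    have hfg := lcs_fg _ h
    set Z := (⊤ : Subgroup G).lowerCentralSeries n with hZ
    have h1 := ih (G := G ⧸ Z) (H.map (QuotientGroup.mk' Z)) (lcs_quot_bot n) (by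
      intro x
      obtain ⟨x, rfl⟩ := QuotientGroup.mk'_surjective Z x
      obtain ⟨k, hk, hx⟩ := hp x
      exact ⟨k, hk, by rw [← map_pow]; exact Subgroup.mem_map_of_mem _ hx⟩)
    rw [← Subgroup.index_comap_of_surjective _ (QuotientGroup.mk'_surjective Z),
      Subgroup.comap_map_eq, QuotientGroup.ker_mk'] at h1
    rw [← Subgroup.relIndex_mul_index (le_sup_left : H ≤ H ⊔ Z)]
    refine mul_ne_zero ?_ h1
    let _ : CommGroup Z := { (inferInstance : Group Z) with
      mul_comm := fun a b => Subtype.ext (Subgroup.mem_center_iff.1 (hc b.2) a) }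
    have : Group.FG Z := (Group.fg_iff_subgroup_fg Z).2 hfg
    have hfin : Finite (Z ⧸ H.subgroupOf Z) := by
      apply CommGroup.finite_of_fg_isMulTorsion
      intro x
      obtain ⟨x, rfl⟩ := QuotientGroup.mk'_surjective _ x
      rw [isOfFinOrder_iff_pow_eq_one]
      obtain ⟨k, hk, hx⟩ := hp x
      exact ⟨k, hk, by
        rw [← map_pow]
        exact (QuotientGroup.eq_one_iff (x ^ k)).2 (by simpa [Subgroup.mem_subgroupOf] using hx)⟩
    have hle : Z ≤ H ⊔ Z := le_sup_right
    have hsurj : Function.Surjective (Quotient.map' (s₁ := QuotientGroup.leftRel (H.subgroupOf Z))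
        (s₂ := QuotientGroup.leftRel (H.subgroupOf (H ⊔ Z))) (Subgroup.inclusion hle) (by
          intro a b hab
          rw [QuotientGroup.leftRel_apply] at hab ⊢
          exact hab)) := by
      intro q
      induction q using Quotient.inductionOn' with
      | h l =>
      obtain ⟨l, hl⟩ := l
      obtain ⟨a, ha, z, hz, rfl⟩ := Subgroup.mem_sup_of_normal_right.1 hl
      refine ⟨Quotient.mk'' ⟨z, hz⟩, ?_⟩
      rw [Quotient.map'_mk'']
      apply Quotient.sound'
      rw [QuotientGroup.leftRel_apply]
      show z⁻¹ * (a * z) ∈ H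
      rw [Subgroup.mem_center_iff.1 (hc hz) a]
      simpa using ha
    have hfin2 := Finite.of_surjective _ hsurj
    exact (Subgroup.finiteIndex_of_finite_quotient (H := H.subgroupOf (H ⊔ Z))).index_ne_zero

theorem stmt7 {G : Type*} [Group G] [Group.FG G] [Group.IsNilpotent G]
    (hZ : ∃ ψ : G → ℤ, (∀ a b : G, ψ (a * b) = ψ a + ψ b) ∧ ∃ g : G, ψ g ≠ 0)
    (S : Set G) :
    (∀ φ : G → ℝ, (∀ a b : G, φ (a * b) = φ a + φ b) → (∃ g : G, φ g ≠ 0) →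
        ∃ s ∈ S, φ s < 0) ↔
      ∃ H : Subgroup G, H.index ≠ 0 ∧
        (H : Set G) = (Subsemigroup.closure S : Subsemigroup G) := by
  constructor
  · intro hS
    obtain ⟨n, hn⟩ := Subgroup.nilpotent_iff_lowerCentralSeries.1 ‹Group.IsNilpotent G›
    obtain ⟨ψ, hψ, g, hg⟩ := hZ
    obtain ⟨s, hs, _⟩ := hS (fun x => (ψ x : ℝ)) (fun a b => by rw [hψ]; push_cast; rfl)
      ⟨g, by exact_mod_cast hg⟩
    have hT := lemT n (Submonoid.closure S) hn (by
      intro φ ha hp x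
      by_contra hx
      obtain ⟨s, hs, hneg⟩ := hS φ ha ⟨x, hx⟩
      exact absurd (hp s (Submonoid.subset_closure hs)) (not_le.2 hneg))
    have hinv : ∀ x ∈ Submonoid.closure S, x⁻¹ ∈ Submonoid.closure S := by
      intro x hx
      obtain ⟨k, hk, h⟩ := hT x⁻¹
      have : x⁻¹ = x ^ (k - 1) * x⁻¹ ^ k := by
        obtain ⟨j, rfl⟩ := Nat.exists_eq_add_of_lt hk
        simp [pow_succ]
      rw [this]
      exact mul_mem (pow_mem hx _) h
    have hcl : ∀ x ∈ Submonoid.closure S, x ∈ Subsemigroup.closure S ∨ x = 1 := by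
      intro x hx
      induction hx using Submonoid.closure_induction with
      | mem x hx => exact Or.inl (Subsemigroup.subset_closure hx)
      | one => exact Or.inr rfl
      | mul x y _ _ hx hy =>
        rcases hx with hx | rfl
        · rcases hy with hy | rfl
          · exact Or.inl (mul_mem hx hy)
          · simpa using Or.inl hx
        · simpa using hy
    have hone : (1 : G) ∈ Subsemigroup.closure S := by
      have hs' : s ∈ Subsemigroup.closure S := Subsemigroup.subset_closure hs
      rcases hcl _ (hinv s (Submonoid.subset_closure hs)) with h | h
      · have := mul_mem hs' h
        rwa [mul_inv_cancel] at this
      · rw [inv_eq_one] at h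
        rwa [h] at hs'
    let H : Subgroup G := { Submonoid.closure S with inv_mem' := fun {x} hx => hinv x hx }
    refine ⟨H, lemI n H hn hT, ?_⟩
    ext x
    constructor
    · intro hx
      rcases hcl x hx with h | rfl
      · exact h
      · exact hone
    · intro hx
      have hx' : x ∈ Subsemigroup.closure S := hx
      have hle : Subsemigroup.closure S ≤ (Submonoid.closure S).toSubsemigroup :=
        Subsemigroup.closure_le.2 Submonoid.subset_closure
      exact hle hx'
  · rintro ⟨H, hH, he⟩ φ hφ ⟨g, hg⟩
    by_contra hcon
    push Not at hcon
    have h0 : ∀ x ∈ Subsemigroup.closure S, 0 ≤ φ x := by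
      intro x hx
      induction hx using Subsemigroup.closure_induction with
      | mem x hx => exact hcon x hx
      | mul x y _ _ h1 h2 => rw [hφ]; linarith
    have h1 : ∀ x ∈ H, 0 ≤ φ x := by
      intro x hx
      apply h0
      have : x ∈ (H : Set G) := hx
      rw [he] at this
      exact this
    have : H.FiniteIndex := ⟨hH⟩
    obtain ⟨k, hk, _, hgk⟩ := H.exists_pow_mem_of_index_ne_zero hH g
    have h2 := h1 _ hgk
    have h3 := h1 _ (inv_mem hgk)
    have h4 := hφ (g ^ k) (g ^ k)⁻¹
    have h5 := phi_pow φ hφ g 0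
    simp only [mul_inv_cancel, pow_zero, Nat.cast_zero, zero_mul] at h4 h5
    have h6 := phi_pow φ hφ g k
    have h7 : (k : ℝ) * φ g = 0 := by linarith
    rcases mul_eq_zero.1 h7 with h | h
    · have : k = 0 := by exact_mod_cast h
      omega
    · exact hg h
end

section
/- Let r ≥ 1 and let S ⊆ ℤʳ. Then the following are equivalent: (i) the origin 0 lies in the interior (in ℝʳ) of the convex hull of the image of S under the canonical embedding ℤʳ ↪ ℝʳ; (ii) for every nonzero linear form f : ℝʳ → ℝ there exists s ∈ S with f(s) < 0; (iii) the additive subsemigroup of ℤʳ generated by S is a finite-index subgroup of ℤʳ, i.e., there exists an additive subgroup H of ℤʳ of finite index whose underlying set equals the subsemigroup generated by S. -/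
theorem aux_i_ii (r : ℕ) (S : Set (Fin r → ℝ)) (h : (0 : Fin r → ℝ) ∈ interior (convexHull ℝ S))
    (f : (Fin r → ℝ) →ₗ[ℝ] ℝ) (hf : f ≠ 0) : ∃ s ∈ S, f s < 0 := by
  by_contra hcon
  push Not at hcon
  have hsub : convexHull ℝ S ⊆ {x | 0 ≤ f x} :=
    convexHull_min hcon (convex_halfSpace_ge f.isLinear 0)
  obtain ⟨v, hv⟩ : ∃ v, f v ≠ 0 := by
    by_contra hh
    push Not at hh
    exact hf (LinearMap.ext hh)
  have key : ∀ v, 0 ≤ f v := by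
    intro v
    have hc : Continuous fun t : ℝ => t • v := by fun_prop
    have hn : (fun t : ℝ => t • v) ⁻¹' (convexHull ℝ S) ∈ nhds (0 : ℝ) := by
      apply hc.continuousAt.preimage_mem_nhds
      simpa using mem_interior_iff_mem_nhds.mp h
    obtain ⟨e, he, hb⟩ := Metric.mem_nhds_iff.mp hn
    have h1 : (e / 2) ∈ Metric.ball (0 : ℝ) e := by
      simp [abs_of_pos he]
      linarith
    have h2 : 0 ≤ f ((e/2) • v) := hsub (hb h1)
    rw [map_smul, smul_eq_mul] at h2
    exact nonneg_of_mul_nonneg_right h2 (by positivity)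
  have h1 := key v
  have h2 := key (-v)
  rw [map_neg] at h2
  exact hv (by linarith)

theorem aux_ii_i (r : ℕ) (hr : 1 ≤ r) (S : Set (Fin r → ℝ))
    (h : ∀ f : (Fin r → ℝ) →ₗ[ℝ] ℝ, f ≠ 0 → ∃ s ∈ S, f s < 0) :
    (0 : Fin r → ℝ) ∈ interior (convexHull ℝ S) := by
  by_contra h0
  have hne : S.Nonempty := by
    obtain ⟨s, hs, _⟩ := h (LinearMap.proj ⟨0, hr⟩) (by
      intro hh
      have := LinearMap.congr_fun hh (fun _ => 1)
      simp at this)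
    exact ⟨s, hs⟩
  by_cases hint : (interior (convexHull ℝ S)).Nonempty
  · obtain ⟨f, hf⟩ := geometric_hahn_banach_open_point
      (convex_convexHull ℝ S).interior isOpen_interior h0
    simp only [map_zero] at hf
    obtain ⟨a, ha⟩ := hint
    have hle : ∀ s ∈ S, f s ≤ 0 := by
      intro s hs
      have h1 : s ∈ closure (interior (convexHull ℝ S)) := by
        rw [(convex_convexHull ℝ S).closure_interior_eq_closure_of_nonempty_interior ⟨a, ha⟩]
        exact subset_closure (subset_convexHull ℝ S hs)
      exact closure_minimal (fun x hx => (hf x hx).le)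
        (isClosed_le f.continuous continuous_const) h1
    obtain ⟨s, hs, hlt⟩ := h (-(f : (Fin r → ℝ) →ₗ[ℝ] ℝ)) (by
      intro hh
      have := LinearMap.congr_fun hh a
      have h2 := hf a ha
      simp at this
      linarith)
    have := hle s hs
    simp at hlt
    linarith
  · rw [interior_convexHull_nonempty_iff_affineSpan_eq_top,
      AffineSubspace.affineSpan_eq_top_iff_vectorSpan_eq_top_of_nonempty ℝ _ _ hne] at hint
    obtain ⟨f, hf, hk⟩ := Submodule.exists_le_ker_of_lt_top _ (lt_top_iff_ne_top.mpr hint)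
    obtain ⟨s, hs, h1⟩ := h f hf
    obtain ⟨t, ht, h2⟩ := h (-f) (neg_ne_zero.mpr hf)
    have h3 := hk (vsub_mem_vectorSpan ℝ hs ht)
    simp at h3 h2
    linarith

theorem aux_iii_ii (r : ℕ) (S : Set (Fin r → ℤ)) (H : AddSubgroup (Fin r → ℤ)) (hi : H.index ≠ 0)
    (hH : (H : Set (Fin r → ℤ)) = (AddSubsemigroup.closure S : AddSubsemigroup (Fin r → ℤ)))
    (f : (Fin r → ℝ) →ₗ[ℝ] ℝ) (hf : f ≠ 0) : ∃ s ∈ S, f (fun i => (s i : ℝ)) < 0 := by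
  by_contra hcon
  push Not at hcon
  have key : ∀ v ∈ H, 0 ≤ f (fun i => (v i : ℝ)) := by
    intro v hv
    have hv' : v ∈ AddSubsemigroup.closure S := by
      rw [← SetLike.mem_coe, ← hH]; exact hv
    induction hv' using AddSubsemigroup.closure_induction with
    | mem x hx => exact hcon x hx
    | add x y hx hy h1 h2 =>
      have e : (fun i => (((x + y) i : ℤ) : ℝ)) = (fun i => (x i : ℝ)) + fun i => (y i : ℝ) := by
        ext i; simp
      rw [e, map_add]
      have h1 := h1 (by rw [← SetLike.mem_coe, hH]; exact hx)
      have h2 := h2 (by rw [← SetLike.mem_coe, hH]; exact hy)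
      linarith
  apply hf
  apply (Pi.basisFun ℝ (Fin r)).ext
  intro i
  have hm : H.index • (Pi.single i 1 : Fin r → ℤ) ∈ H := AddSubgroup.nsmul_index_mem H _
  have h1 := key _ hm
  have h2 := key _ (H.neg_mem hm)
  have e1 : (fun j => (((H.index • (Pi.single i 1 : Fin r → ℤ)) j : ℤ) : ℝ))
      = (H.index : ℝ) • (Pi.single i 1 : Fin r → ℝ) := by
    ext j; by_cases hj : j = i
    · subst hj; simp
    · simp [hj]
  have e2 : (fun j => (((-(H.index • (Pi.single i 1 : Fin r → ℤ))) j : ℤ) : ℝ))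
      = -((H.index : ℝ) • (Pi.single i 1 : Fin r → ℝ)) := by
    rw [← e1]; ext j; simp
  rw [e1] at h1
  rw [e2, map_neg] at h2
  have h3 : f ((H.index : ℝ) • (Pi.single i 1 : Fin r → ℝ)) = 0 := by linarith
  rw [map_smul, smul_eq_mul, mul_eq_zero] at h3
  have : (H.index : ℝ) ≠ 0 := by exact_mod_cast hi
  simpa [this] using h3

theorem aux_rat (r : ℕ) (S : Set (Fin r → ℤ))
    (h : (0 : Fin r → ℝ) ∈
        interior (convexHull ℝ ((fun v : Fin r → ℤ => fun i => (v i : ℝ)) '' S)))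
    (v : Fin r → ℤ) : ∃ D : ℕ, 0 < D ∧ D • v ∈ AddSubmonoid.closure S := by
  obtain ⟨N, hN, hmem⟩ : ∃ N : ℕ, 0 < N ∧ ((1 / (N : ℝ)) • (fun i => (v i : ℝ))) ∈
      convexHull ℝ ((fun v : Fin r → ℤ => fun i => (v i : ℝ)) '' S) := by
    have hc : Continuous fun t : ℝ => t • (fun i => (v i : ℝ)) := by fun_prop
    have hn : (fun t : ℝ => t • (fun i => (v i : ℝ))) ⁻¹'
        (convexHull ℝ ((fun v : Fin r → ℤ => fun i => (v i : ℝ)) '' S)) ∈ nhds (0 : ℝ) := by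
      apply hc.continuousAt.preimage_mem_nhds
      simpa using mem_interior_iff_mem_nhds.mp h
    obtain ⟨e, he, hb⟩ := Metric.mem_nhds_iff.mp hn
    obtain ⟨n, hn⟩ := exists_nat_one_div_lt he
    refine ⟨n + 1, Nat.succ_pos _, hb ?_⟩
    rw [mem_ball_zero_iff, Real.norm_of_nonneg (by positivity)]
    push_cast
    exact hn
  obtain ⟨ι, _, z, w, hz, hai, hw, hw1, hsum⟩ := eq_pos_convex_span_of_mem_convexHull hmem
  have hz' : ∀ i, ∃ s ∈ S, (fun j => (s j : ℝ)) = z i := fun i => hz ⟨i, rfl⟩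
  choose s hs hsz using hz'
  obtain ⟨p, hp⟩ : ∃ p : ℝ →ₗ[ℚ] ℚ, p 1 = 1 := by
    obtain ⟨p, hp⟩ := (Algebra.linearMap ℚ ℝ).exists_leftInverse_of_injective
      (LinearMap.ker_eq_bot.mpr (algebraMap ℚ ℝ).injective)
    exact ⟨p, by simpa using LinearMap.congr_fun hp 1⟩
  have hpq : ∀ (x : ℝ) (q : ℚ), p (x * q) = p x * q := by
    intro x q
    have : x * q = q • x := by rw [Rat.smul_def, mul_comm]
    rw [this, map_smul, smul_eq_mul, mul_comm]
  have hpq' : ∀ (q : ℚ), p q = q := by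
    intro q
    have := hpq 1 q
    simpa [hp] using this
  have hsum' : ∀ j, ∑ i, w i * (s i j : ℝ) = (((v j : ℚ) / N : ℚ) : ℝ) := by
    intro j
    have := congrFun hsum j
    simp only [Finset.sum_apply, Pi.smul_apply, smul_eq_mul, ← hsz] at this
    rw [this]; push_cast; ring
  have hP1 : ∑ i, p (w i) = 1 := by rw [← map_sum, hw1, hp]
  have hPs : ∀ j, ∑ i, p (w i) * (s i j : ℚ) = (v j : ℚ) / N := by
    intro j
    have := congrArg p (hsum' j)
    rw [hpq', map_sum] at this
    rw [← this]
    refine Finset.sum_congr rfl fun i _ => ?_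
    rw [← hpq]; norm_cast
  have hwp : ∀ i, w i = (p (w i) : ℝ) := by
    have := (affineIndependent_iff.mp hai) Finset.univ (fun i => w i - (p (w i) : ℝ))
      (by
        rw [Finset.sum_sub_distrib, hw1]
        have : ((∑ i, p (w i) : ℚ) : ℝ) = 1 := by rw [hP1]; simp
        push_cast at this
        rw [this, sub_self])
      (by
        ext j
        have h1 := hsum' j
        have h2 : ((∑ i, p (w i) * (s i j : ℚ) : ℚ) : ℝ) = (((v j : ℚ) / N : ℚ) : ℝ) := by
          rw [hPs j]
        rw [← h1] at h2
        push_cast at h2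
        simp only [Finset.sum_apply, Pi.smul_apply, smul_eq_mul, ← hsz, sub_mul,
          Finset.sum_sub_distrib, h2, sub_self, Pi.zero_apply])
    intro i
    have := this i (Finset.mem_univ i)
    linarith
  have hq : ∀ i, 0 < p (w i) := by
    intro i
    have := hw i
    rw [hwp i] at this
    exact_mod_cast this
  let E : ℕ := ∏ i, (p (w i)).den
  have hE : 0 < E := Finset.prod_pos fun i _ => (p (w i)).den_pos
  have hn : ∀ i, ∃ n : ℕ, (n : ℚ) = E * p (w i) := by
    intro i
    obtain ⟨k, hk⟩ : (p (w i)).den ∣ E := Finset.dvd_prod_of_mem _ (Finset.mem_univ i)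
    refine ⟨k * (p (w i)).num.toNat, ?_⟩
    have h1 : (((p (w i)).num.toNat : ℤ) : ℚ) = (p (w i)).num := by
      rw [Int.toNat_of_nonneg (Rat.num_pos.mpr (hq i)).le]
    rw [hk]
    push_cast at h1 ⊢
    rw [h1, ← Rat.mul_den_eq_num (p (w i))]
    ring
  choose n hn using hn
  refine ⟨E, hE, ?_⟩
  have : E • v = N • ∑ i, n i • s i := by
    ext j
    have h1 := hPs j
    have hN' : (N : ℚ) ≠ 0 := by exact_mod_cast hN.ne'
    rw [eq_div_iff hN'] at h1
    have : ((E : ℚ) * (v j : ℚ)) = N * ∑ i, (n i : ℚ) * (s i j : ℚ) := by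
      rw [← h1]
      simp only [hn, mul_assoc, ← Finset.mul_sum]
      ring
    simp only [Pi.smul_apply, Finset.sum_apply, nsmul_eq_mul]
    exact_mod_cast this
  rw [this]
  exact AddSubmonoid.nsmul_mem _ (AddSubmonoid.sum_mem _ fun i _ =>
    AddSubmonoid.nsmul_mem _ (AddSubmonoid.subset_closure (hs i)) _) _

theorem aux_i_iii (r : ℕ) (S : Set (Fin r → ℤ))
    (h : (0 : Fin r → ℝ) ∈
        interior (convexHull ℝ ((fun v : Fin r → ℤ => fun i => (v i : ℝ)) '' S))) :
    ∃ H : AddSubgroup (Fin r → ℤ), H.index ≠ 0 ∧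
        (H : Set (Fin r → ℤ)) = (AddSubsemigroup.closure S : AddSubsemigroup (Fin r → ℤ)) := by
  have key := aux_rat r S h
  have hneg : ∀ x ∈ AddSubmonoid.closure S, -x ∈ AddSubmonoid.closure S := by
    intro x hx
    obtain ⟨D, hD, hm⟩ := key (-x)
    obtain ⟨k, rfl⟩ : ∃ k, D = k + 1 := ⟨D - 1, by omega⟩
    have : -x = k • x + (k + 1) • (-x) := by
      rw [add_smul, one_smul, smul_neg]; abel
    rw [this]
    exact add_mem (AddSubmonoid.nsmul_mem _ hx _) hm
  obtain ⟨s, hs⟩ : S.Nonempty := by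
    have : (convexHull ℝ ((fun v : Fin r → ℤ => fun i => (v i : ℝ)) '' S)).Nonempty :=
      ⟨0, interior_subset h⟩
    rw [convexHull_nonempty_iff] at this
    exact this.of_image
  have hadd : ∀ m ∈ AddSubmonoid.closure S, ∀ t ∈ AddSubsemigroup.closure S,
      t + m ∈ AddSubsemigroup.closure S := by
    intro m hm
    induction hm using AddSubmonoid.closure_induction with
    | mem x hx => exact fun t ht => add_mem ht (AddSubsemigroup.subset_closure hx)
    | zero => intro t ht; simpa using ht
    | add x y _ _ h1 h2 =>
      intro t ht
      rw [← add_assoc]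
      exact h2 _ (h1 _ ht)
  have h0 : (0 : Fin r → ℤ) ∈ AddSubsemigroup.closure S := by
    have := hadd _ (hneg s (AddSubmonoid.subset_closure hs)) s (AddSubsemigroup.subset_closure hs)
    simpa using this
  let H : AddSubgroup (Fin r → ℤ) :=
    { AddSubmonoid.closure S with neg_mem' := fun {x} hx => hneg x hx }
  have hHm : ∀ x, x ∈ H ↔ x ∈ AddSubmonoid.closure S := fun x => Iff.rfl
  refine ⟨H, ?_, ?_⟩
  · have ht : AddMonoid.IsTorsion ((Fin r → ℤ) ⧸ H) := by
      intro q
      obtain ⟨v, rfl⟩ := QuotientAddGroup.mk_surjective q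
      obtain ⟨D, hD, hm⟩ := key v
      rw [isOfFinAddOrder_iff_nsmul_eq_zero]
      refine ⟨D, hD, ?_⟩
      rw [← QuotientAddGroup.mk_nsmul, QuotientAddGroup.eq_zero_iff]
      exact hm
    haveI : Finite ((Fin r → ℤ) ⧸ H) := AddCommGroup.finite_of_fg_torsion _ ht
    exact AddSubgroup.index_ne_zero_of_finite
  · ext x
    simp only [SetLike.mem_coe, hHm]
    constructor
    · intro hx
      simpa using hadd x hx 0 h0
    · intro hx
      induction hx using AddSubsemigroup.closure_induction with
      | mem x hx => exact AddSubmonoid.subset_closure hx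
      | add x y _ _ h1 h2 => exact add_mem h1 h2

theorem stmt8 (r : ℕ) (hr : 1 ≤ r) (S : Set (Fin r → ℤ)) :
    (((0 : Fin r → ℝ) ∈
        interior (convexHull ℝ ((fun v : Fin r → ℤ => fun i => (v i : ℝ)) '' S)) ↔
      ∀ f : (Fin r → ℝ) →ₗ[ℝ] ℝ, f ≠ 0 → ∃ s ∈ S, f (fun i => (s i : ℝ)) < 0)) ∧
    (((0 : Fin r → ℝ) ∈
        interior (convexHull ℝ ((fun v : Fin r → ℤ => fun i => (v i : ℝ)) '' S)) ↔
      ∃ H : AddSubgroup (Fin r → ℤ), H.index ≠ 0 ∧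
        (H : Set (Fin r → ℤ)) = (AddSubsemigroup.closure S : AddSubsemigroup (Fin r → ℤ)))) := by
  have h12 : ((0 : Fin r → ℝ) ∈
        interior (convexHull ℝ ((fun v : Fin r → ℤ => fun i => (v i : ℝ)) '' S)) ↔
      ∀ f : (Fin r → ℝ) →ₗ[ℝ] ℝ, f ≠ 0 → ∃ s ∈ S, f (fun i => (s i : ℝ)) < 0) := by
    constructor
    · intro h f hf
      obtain ⟨_, ⟨s, hs, rfl⟩, h2⟩ := aux_i_ii r _ h f hf
      exact ⟨s, hs, h2⟩
    · intro h
      refine aux_ii_i r hr _ fun f hf => ?_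
      obtain ⟨s, hs, h2⟩ := h f hf
      exact ⟨_, ⟨s, hs, rfl⟩, h2⟩
  refine ⟨h12, aux_i_iii r S, ?_⟩
  rintro ⟨H, hi, hH⟩
  exact h12.mpr (aux_iii_ii r S H hi hH)
end

section
/- Let r ≥ 1 and let S be a finite subset of ℤʳ such that the origin 0 lies in the interior (in ℝʳ) of the convex hull of the image of S under the canonical embedding ℤʳ ↪ ℝʳ. Then for every s ∈ S, the element −s lies in the additive subsemigroup of ℤʳ generated by S; in particular, this subsemigroup is a subgroup of ℤʳ. -/
lemma aux_dirichlet {ι : Type*} [Fintype ι] (c : ι → ℝ) (δ : ℝ) (hδ : 0 < δ) :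
    ∃ N : ℕ, 0 < N ∧ ∃ m : ι → ℤ, ∀ i, |(N : ℝ) * c i - m i| < δ := by
  have hK : IsCompact (Set.Icc (0 : ι → ℝ) 1) := isCompact_Icc
  obtain ⟨a, -, φ, hφ, hlim⟩ := hK.tendsto_subseq (x := fun n : ℕ => fun i => Int.fract ((n : ℝ) * c i))
    (fun n => ⟨fun i => Int.fract_nonneg _, fun i => (Int.fract_lt_one _).le⟩)
  have hc := hlim.cauchySeq
  obtain ⟨n, hn⟩ := Metric.cauchySeq_iff.1 hc δ hδ
  have h := hn (n + 1) (by omega) n le_rfl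
  have hlt : φ n < φ (n + 1) := hφ (by omega)
  refine ⟨φ (n + 1) - φ n, by omega, fun i => ⌊(φ (n + 1) : ℝ) * c i⌋ - ⌊(φ n : ℝ) * c i⌋, fun i => ?_⟩
  have h2 := (dist_le_pi_dist _ _ i).trans_lt h
  simp only [Function.comp, Real.dist_eq, ← Int.self_sub_floor] at h2
  rw [Nat.cast_sub hlt.le]
  push_cast
  refine lt_of_eq_of_lt (congrArg _ ?_) h2
  ring

lemma aux_monoid {A : Type*} [AddCommGroup A] (S : Set A) (x : A)
    (hx : x ∈ AddSubmonoid.closure S) : x = 0 ∨ x ∈ AddSubsemigroup.closure S := by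
  induction hx using AddSubmonoid.closure_induction with
  | mem x h => exact Or.inr (AddSubsemigroup.subset_closure h)
  | zero => exact Or.inl rfl
  | add x y _ _ hx hy =>
    rcases hx with rfl | hx
    · simpa using hy
    · rcases hy with rfl | hy
      · simpa using Or.inr hx
      · exact Or.inr (add_mem hx hy)

lemma aux_neg (r : ℕ) (S : Set (Fin r → ℤ)) (hS : S.Finite)
    (h0 : (0 : Fin r → ℝ) ∈
      interior (convexHull ℝ ((fun v : Fin r → ℤ => fun i => (v i : ℝ)) '' S)))
    (s : Fin r → ℤ) (hs : s ∈ S) : -s ∈ AddSubsemigroup.closure S := by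
  classical
  set e : (Fin r → ℤ) → (Fin r → ℝ) := fun v i => (v i : ℝ) with he
  have hinj : Function.Injective e := by
    intro a b hab
    ext i
    have := congrFun hab i
    simpa [he] using this
  obtain ⟨T, rfl⟩ := hS.exists_finset_coe
  -- small multiple of `-s` in the hull
  obtain ⟨ε, hε, hmem⟩ : ∃ ε : ℝ, 0 < ε ∧ ε • (-(e s)) ∈ convexHull ℝ (e '' (T : Set (Fin r → ℤ))) := by
    have hcont : Filter.Tendsto (fun t : ℝ => t • (-(e s))) (nhdsWithin 0 (Set.Ioi 0)) (nhds 0) := by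
      have : Continuous (fun t : ℝ => t • (-(e s))) := by fun_prop
      have h := this.tendsto 0
      rw [zero_smul] at h
      exact h.mono_left nhdsWithin_le_nhds
    have h1 := hcont.eventually (mem_interior_iff_mem_nhds.1 h0)
    obtain ⟨t, ht, ht'⟩ := (h1.and self_mem_nhdsWithin).exists
    exact ⟨t, ht', ht⟩
  rw [← Finset.coe_image, Finset.mem_convexHull'] at hmem
  obtain ⟨w, hw, -, hsum⟩ := hmem
  rw [Finset.sum_image (fun a _ b _ h => hinj h)] at hsum
  set c : (Fin r → ℤ) → ℝ := fun t => w (e t) + if t = s then ε else 0 with hc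
  have hsT : s ∈ T := hs
  have hcs : ∀ t ∈ T, 0 ≤ c t := fun t ht => by
    have := hw (e t) (Finset.mem_image_of_mem _ ht)
    simp only [hc]; split_ifs <;> linarith
  have hcpos : ε ≤ c s := by
    have := hw (e s) (Finset.mem_image_of_mem _ hsT)
    simp only [hc, if_true]; linarith
  have hrel : ∀ i, ∑ t ∈ T, c t * (t i : ℝ) = 0 := by
    intro i
    have h1 := congrFun hsum i
    simp only [Finset.sum_apply, Pi.smul_apply, Pi.neg_apply, smul_eq_mul, he] at h1
    simp only [hc, add_mul, Finset.sum_add_distrib, ite_mul, zero_mul, Finset.sum_ite_eq', hsT, if_true]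
    simp only [he]
    rw [h1]; ring
  set B : ℝ := ∑ t ∈ T, ∑ i, |(t i : ℝ)| with hB
  have hB0 : 0 ≤ B := by positivity
  have hBi : ∀ i, ∑ t ∈ T, |(t i : ℝ)| ≤ B := fun i =>
    Finset.sum_le_sum fun t _ =>
      Finset.single_le_sum (f := fun i => |(t i : ℝ)|) (fun _ _ => abs_nonneg _) (Finset.mem_univ i)
  set δ : ℝ := min (min ε 1) (1 / (B + 1)) with hδ
  have hδ0 : 0 < δ := by positivity
  have hδε : δ ≤ ε := (min_le_left _ _).trans (min_le_left _ _)
  have hδ1 : δ ≤ 1 := (min_le_left _ _).trans (min_le_right _ _)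
  have hδB : δ * B < 1 := by
    have h : δ ≤ 1 / (B + 1) := min_le_right _ _
    rw [le_div_iff₀ (by positivity)] at h
    nlinarith
  obtain ⟨N, hN, m', hm'⟩ := aux_dirichlet (fun t : T => c t) δ hδ0
  obtain ⟨m, hm⟩ : ∃ m : (Fin r → ℤ) → ℤ, ∀ t ∈ T, |(N : ℝ) * c t - m t| < δ :=
    ⟨fun t => if h : t ∈ T then m' ⟨t, h⟩ else 0, fun t ht => by simpa [ht] using hm' ⟨t, ht⟩⟩
  have hN1 : (1 : ℝ) ≤ N := by exact_mod_cast hN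
  have hm0 : ∀ t ∈ T, 0 ≤ m t := by
    intro t ht
    have h1 := (abs_lt.1 (hm t ht)).2
    have h2 : 0 ≤ (N : ℝ) * c t := mul_nonneg (by positivity) (hcs t ht)
    have h3 : (-1 : ℝ) < m t := by linarith
    have h4 : (-1 : ℤ) < m t := by exact_mod_cast h3
    omega
  have hms : 1 ≤ m s := by
    have h1 := (abs_lt.1 (hm s hsT)).2
    have h2 : ε ≤ (N : ℝ) * c s := by nlinarith
    have h3 : (0 : ℝ) < m s := by linarith
    have h4 : (0 : ℤ) < m s := by exact_mod_cast h3
    omega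
  have hzero : ∑ t ∈ T, m t • t = 0 := by
    ext i
    simp only [Finset.sum_apply, Pi.smul_apply, smul_eq_mul, Pi.zero_apply]
    have h1 : |((∑ t ∈ T, m t * t i : ℤ) : ℝ)| < 1 := by
      push_cast
      have h2 : ∑ t ∈ T, (m t : ℝ) * (t i : ℝ) = ∑ t ∈ T, -((N : ℝ) * c t - m t) * (t i : ℝ) := by
        have h3 : ∑ t ∈ T, -((N : ℝ) * c t - m t) * (t i : ℝ)
            = ∑ t ∈ T, (m t : ℝ) * (t i : ℝ) - N * ∑ t ∈ T, c t * (t i : ℝ) := by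
          rw [Finset.mul_sum, ← Finset.sum_sub_distrib]
          exact Finset.sum_congr rfl fun t _ => by ring
        rw [h3, hrel i]; ring
      rw [h2]
      calc _ ≤ ∑ t ∈ T, |-((N : ℝ) * c t - m t) * (t i : ℝ)| := Finset.abs_sum_le_sum_abs _ _
        _ ≤ ∑ t ∈ T, δ * |(t i : ℝ)| := Finset.sum_le_sum fun t ht => by
            rw [abs_mul, abs_neg]
            exact mul_le_mul_of_nonneg_right (hm t ht).le (abs_nonneg _)
        _ = δ * ∑ t ∈ T, |(t i : ℝ)| := by rw [Finset.mul_sum]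
        _ ≤ δ * B := mul_le_mul_of_nonneg_left (hBi i) hδ0.le
        _ < 1 := hδB
    have h2 : |∑ t ∈ T, m t * t i| < 1 := by exact_mod_cast h1
    exact Int.abs_lt_one_iff.1 h2
  have hsm : ∀ t ∈ T, ∀ k : ℤ, 0 ≤ k → k • t ∈ AddSubmonoid.closure (T : Set (Fin r → ℤ)) := by
    intro t ht k hk
    obtain ⟨n, rfl⟩ := Int.eq_ofNat_of_zero_le hk
    rw [natCast_zsmul]
    exact nsmul_mem (AddSubmonoid.subset_closure ht) n
  have hneg : -s ∈ AddSubmonoid.closure (T : Set (Fin r → ℤ)) := by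
    have h1 : -s = (m s - 1) • s + ∑ t ∈ T.erase s, m t • t := by
      rw [← Finset.add_sum_erase _ _ hsT] at hzero
      rw [sub_smul, one_smul, eq_neg_of_add_eq_zero_left hzero]
      abel
    rw [h1]
    refine add_mem (hsm s hsT _ (by omega)) (sum_mem fun t ht => ?_)
    have := Finset.mem_of_mem_erase ht
    exact hsm t this _ (hm0 t this)
  rcases aux_monoid _ _ hneg with h | h
  · rw [h, ← neg_eq_zero.1 h]
    exact AddSubsemigroup.subset_closure hs
  · exact h

theorem stmt9 (r : ℕ) (hr : 1 ≤ r) (S : Set (Fin r → ℤ)) (hS : S.Finite)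
    (h0 : (0 : Fin r → ℝ) ∈
      interior (convexHull ℝ ((fun v : Fin r → ℤ => fun i => (v i : ℝ)) '' S))) :
    (∀ s ∈ S, -s ∈ AddSubsemigroup.closure S) ∧
      ∃ H : AddSubgroup (Fin r → ℤ),
        (H : Set (Fin r → ℤ)) = (AddSubsemigroup.closure S : AddSubsemigroup (Fin r → ℤ)) := by
  have key := aux_neg r S hS h0
  refine ⟨key, ?_⟩
  obtain ⟨s, hs⟩ : S.Nonempty := by
    have h := convexHull_nonempty_iff.1 ⟨_, interior_subset h0⟩
    exact Set.image_nonempty.1 h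
  refine ⟨{ carrier := (AddSubsemigroup.closure S : AddSubsemigroup (Fin r → ℤ))
            add_mem' := fun ha hb => add_mem ha hb
            zero_mem' := ?_
            neg_mem' := ?_ }, rfl⟩
  · have := add_mem (AddSubsemigroup.subset_closure hs) (key s hs)
    rwa [add_neg_cancel] at this
  · intro x hx
    change -x ∈ AddSubsemigroup.closure S
    replace hx : x ∈ AddSubsemigroup.closure S := hx
    induction hx using AddSubsemigroup.closure_induction with
    | mem x h => exact key x h
    | add x y _ _ hx hy => rw [neg_add]; exact add_mem hx hy
end

section
/- Let G be a group, S ⊆ G, and φ : G → ℝ a homomorphism with φ(s) ≥ 0 for all s ∈ S. Let S_new = {s ∈ S : φ(s) = 0}. Then the identity e lies in S⁺ if and only if e lies in S_new⁺. -/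
theorem stmt12 {G : Type*} [Group G] (S : Set G) (φ : G → ℝ)
    (hφ : ∀ a b : G, φ (a * b) = φ a + φ b) (hS : ∀ s ∈ S, 0 ≤ φ s) :
    (1 : G) ∈ Subsemigroup.closure S ↔
      (1 : G) ∈ Subsemigroup.closure {s ∈ S | φ s = 0} := by
  have h1 : φ 1 = 0 := by
    have := hφ 1 1
    rw [mul_one] at this
    linarith
  have key : ∀ x ∈ Subsemigroup.closure S, 0 ≤ φ x ∧
      (φ x = 0 → x ∈ Subsemigroup.closure {s ∈ S | φ s = 0}) := by
    intro x hx
    induction hx using Subsemigroup.closure_induction with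
    | mem x hx => exact ⟨hS x hx, fun h => Subsemigroup.subset_closure ⟨hx, h⟩⟩
    | mul x y _ _ ihx ihy =>
      have hxy := hφ x y
      refine ⟨by linarith [ihx.1, ihy.1], fun h => ?_⟩
      exact mul_mem (ihx.2 (by linarith [ihx.1, ihy.1])) (ihy.2 (by linarith [ihx.1, ihy.1]))
  exact ⟨fun h => (key 1 h).2 h1, fun h => Subsemigroup.closure_mono (fun s hs => hs.1) h⟩
end

section
/- Let c ≥ 2 and let G be a nilpotent group with lowerCentralSeries G c = ⊥ (nilpotency class at most c), and set K = lowerCentralSeries G (c−1), which is a central subgroup of G. Let S ⊆ G and suppose there is a positive integer M such that for every g ∈ G there exist w ∈ S⁺ and z ∈ K with g^M = w·z. Then for every homomorphism φ : K → ℝ, either φ is identically zero, or there exists t ∈ S⁺ with t ∈ K and φ(t) < 0. -/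
theorem aux_comm1 {G : Type*} [Group G] (a b z : G) (hz : ∀ g, z * g = g * z)
    (h : a * b = z * (b * a)) (k : ℕ) : a * b ^ k = z ^ k * (b ^ k * a) := by
  have h1 : a * b * a⁻¹ = z * b := by rw [h]; group
  have h2 : (a * b * a⁻¹) ^ k = (z * b) ^ k := by rw [h1]
  rw [conj_pow, (show Commute z b from hz b).mul_pow] at h2
  rw [← mul_assoc, ← h2]; group

theorem aux_comm2 {G : Type*} [Group G] (a b z : G) (hz : ∀ g, z * g = g * z)
    (h : a * b = z * (b * a)) (m k : ℕ) : a ^ m * b ^ k = z ^ (k * m) * (b ^ k * a ^ m) := by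
  have hzk : ∀ j : ℕ, ∀ g, z ^ j * g = g * z ^ j := fun j g =>
    ((show Commute z g from hz g).pow_left j)
  have h1 := aux_comm1 a b z hz h k
  have h2 : b ^ k * a = (z ^ k)⁻¹ * (a * b ^ k) := by rw [h1]; group
  have h3 : ∀ g, (z ^ k)⁻¹ * g = g * (z ^ k)⁻¹ := fun g =>
    ((show Commute (z ^ k) g from hzk k g).inv_left)
  have h4 := aux_comm1 (b ^ k) a _ h3 h2 m
  rw [h4, pow_mul, inv_pow]; group

theorem aux_pow {G : Type*} [Group G] (T : Subsemigroup G) {w : G} (hw : w ∈ T) (n : ℕ) :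
    w ^ (n + 1) ∈ T := by
  induction n with
  | zero => simpa using hw
  | succ n ih => rw [pow_succ]; exact T.mul_mem ih hw

theorem aux_shuffle {G : Type*} [Group G] (A B C D x y z u : G) (hx : ∀ g, x * g = g * x)
    (hy : ∀ g, y * g = g * y) (hz : ∀ g, z * g = g * z) :
    (A * x) * (B * y) * (C * z) * (D * u) = A * B * C * D * (x * y * z * u) := by
  calc (A * x) * (B * y) * (C * z) * (D * u)
      = A * (x * B) * (y * C) * (z * D) * u := by group
    _ = A * B * (x * C) * (y * D) * z * u := by rw [hx, hy, hz]; group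
    _ = A * B * C * (x * D) * y * z * u := by rw [hx C, hy D]; group
    _ = _ := by rw [hx D]; group

/-- If the value of `φ` on a central commutator is negative, we are done. -/
theorem aux_main {G : Type*} [Group G] (K : Subgroup G) (hK : ∀ x ∈ K, ∀ g : G, x * g = g * x)
    (T : Subsemigroup G) (M : ℕ) (hM : 0 < M)
    (h : ∀ g : G, ∃ w ∈ T, ∃ z ∈ K, g ^ M = w * z)
    (φ : K → ℝ) (hφ : ∀ a b : K, φ (a * b) = φ a + φ b)
    (a b z : G) (hz : z ∈ K) (hab : a * b = z * (b * a)) (hneg : φ ⟨z, hz⟩ < 0) :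
    ∃ t ∈ T, ∃ ht : t ∈ K, φ ⟨t, ht⟩ < 0 := by
  have h' : ∀ g : G, ∃ x ∈ K, g ^ M * x ∈ T := by
    intro g
    obtain ⟨w, hw, z, hz, e⟩ := h g
    exact ⟨z⁻¹, K.inv_mem hz, by rw [e]; simpa using hw⟩
  obtain ⟨x, hx, hxT⟩ := h' a
  obtain ⟨y, hy, hyT⟩ := h' b
  obtain ⟨u, hu, huT⟩ := h' a⁻¹
  obtain ⟨v, hv, hvT⟩ := h' b⁻¹
  have hpow : ∀ (k : K) (n : ℕ), φ (k ^ (n + 1)) = (n + 1 : ℕ) * φ k := by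
    intro k n
    induction n with
    | zero => simp
    | succ n ih => rw [pow_succ, hφ, ih]; push_cast; ring
  have hmain : ∀ n : ℕ, (a ^ M * x) ^ n * (b ^ M * y) ^ n * (a⁻¹ ^ M * u) ^ n * (b⁻¹ ^ M * v) ^ n
      = z ^ (M * n * (M * n)) * (x * y * u * v) ^ n := by
    intro n
    have e : ∀ g k : G, k ∈ K → (g ^ M * k) ^ n = g ^ (M * n) * k ^ n := by
      intro g k hk
      rw [(show Commute (g ^ M) k from (hK k hk _).symm).mul_pow, pow_mul]
    rw [e _ _ hx, e _ _ hy, e _ _ hu, e _ _ hv,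
      aux_shuffle _ _ _ _ _ _ _ _ (hK _ (K.pow_mem hx n)) (hK _ (K.pow_mem hy n))
        (hK _ (K.pow_mem hu n)), aux_comm2 a b z (hK z hz) hab,
      (show Commute (x * y * u) v from hK _ (K.mul_mem (K.mul_mem hx hy) hu) _).mul_pow,
      (show Commute (x * y) u from hK _ (K.mul_mem hx hy) _).mul_pow,
      (show Commute x y from hK _ hx _).mul_pow]
    congr 1
    rw [inv_pow, inv_pow]; group
  set p : K := ⟨z, hz⟩ with hp
  set q : K := ⟨x * y * u * v, K.mul_mem (K.mul_mem (K.mul_mem hx hy) hu) hv⟩ with hq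
  obtain ⟨n, hn⟩ := exists_nat_gt (φ q / (-φ p))
  rw [div_lt_iff₀ (by linarith)] at hn
  have hT := T.mul_mem (T.mul_mem (T.mul_mem (aux_pow T hxT n) (aux_pow T hyT n))
    (aux_pow T huT n)) (aux_pow T hvT n)
  rw [hmain] at hT
  refine ⟨_, hT, (p ^ (M * (n + 1) * (M * (n + 1))) * q ^ (n + 1)).2, ?_⟩
  change φ (p ^ (M * (n + 1) * (M * (n + 1))) * q ^ (n + 1)) < 0
  have hpos : 0 < M * (n + 1) * (M * (n + 1)) := by positivity
  obtain ⟨r, hr⟩ : ∃ r, M * (n + 1) * (M * (n + 1)) = r + 1 := ⟨_, (Nat.succ_pred_eq_of_pos hpos).symm⟩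
  rw [hφ, hr, hpow, hpow, ← hr]
  push_cast
  have hM1 : (1 : ℝ) ≤ M := by exact_mod_cast hM
  have hn0 : (0 : ℝ) ≤ n := by positivity
  have hMM : (1 : ℝ) ≤ (M : ℝ) * M := by nlinarith
  have h1 : ((M : ℝ) * M) * ((n + 1) * φ p) ≤ 1 * ((n + 1) * φ p) :=
    mul_le_mul_of_nonpos_right hMM (by nlinarith)
  have h2 : ((M : ℝ) * M) * ((n + 1) * φ p) + φ q < 0 := by linarith
  nlinarith

open scoped commutatorElement in
theorem stmt13 {G : Type*} [Group G] (c : ℕ) (hc : 2 ≤ c)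
    (hG : Subgroup.lowerCentralSeries (⊤ : Subgroup G) c = ⊥) (S : Set G) (M : ℕ) (hM : 0 < M)
    (h : ∀ g : G, ∃ w ∈ Subsemigroup.closure S,
      ∃ z ∈ Subgroup.lowerCentralSeries (⊤ : Subgroup G) (c - 1), g ^ M = w * z)
    (φ : ↥(Subgroup.lowerCentralSeries (⊤ : Subgroup G) (c - 1)) → ℝ)
    (hφ : ∀ a b : ↥(Subgroup.lowerCentralSeries (⊤ : Subgroup G) (c - 1)), φ (a * b) = φ a + φ b) :
    (∀ x : ↥(Subgroup.lowerCentralSeries (⊤ : Subgroup G) (c - 1)), φ x = 0) ∨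
      ∃ t ∈ Subsemigroup.closure S, ∃ ht : t ∈ Subgroup.lowerCentralSeries (⊤ : Subgroup G) (c - 1),
        φ ⟨t, ht⟩ < 0 := by
  obtain ⟨d, rfl⟩ : ∃ d, c = d + 2 := ⟨c - 2, by omega⟩
  have hd : d + 2 - 1 = d + 1 := by omega
  have hK : ∀ x ∈ Subgroup.lowerCentralSeries (⊤ : Subgroup G) (d + 2 - 1),
      ∀ g : G, x * g = g * x := by
    intro x hx g
    have h1 : ⁅x, g⁆ ∈ Subgroup.lowerCentralSeries (⊤ : Subgroup G) (d + 2) :=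
      Subgroup.commutator_mem_commutator hx (Subgroup.mem_top g)
    rw [hG, Subgroup.mem_bot] at h1
    exact commutatorElement_eq_one_iff_mul_comm.mp h1
  by_contra hcon
  rw [not_or] at hcon
  obtain ⟨hne, hno⟩ := hcon
  apply hne
  have hone : φ 1 = 0 := by
    have := hφ 1 1
    rw [mul_one] at this; linarith
  have hinv : ∀ k, φ k⁻¹ = - φ k := by
    intro k
    have := hφ k k⁻¹
    rw [mul_inv_cancel, hone] at this; linarith
  have key : ∀ (a b z : G) (hz : z ∈ Subgroup.lowerCentralSeries (⊤ : Subgroup G) (d + 2 - 1)),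
      a * b = z * (b * a) → 0 ≤ φ ⟨z, hz⟩ := by
    intro a b z hz hab
    by_contra hlt
    exact hno (aux_main _ hK _ M hM h φ hφ a b z hz hab (not_le.mp hlt))
  rintro ⟨x, hx⟩
  have hx' : x ∈ Subgroup.closure { g | ∃ p ∈ Subgroup.lowerCentralSeries (⊤ : Subgroup G) d,
      ∃ q ∈ (⊤ : Subgroup G), ⁅p, q⁆ = g } := hx
  induction hx' using Subgroup.closure_induction with
  | mem g hg =>
    obtain ⟨p, -, q, -, rfl⟩ := hg
    have h1 := key p q _ hx (by rw [commutatorElement_def]; group)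
    have h2 := key q p _ (Subgroup.inv_mem _ hx) (by rw [commutatorElement_def]; group)
    have h3 := hinv ⟨_, hx⟩
    change φ ⟨⁅p, q⁆⁻¹, _⟩ = _ at h3
    linarith
  | one => exact hone
  | mul y z hy hz ihy ihz =>
    have := hφ ⟨y, hy⟩ ⟨z, hz⟩
    rw [ihy hy, ihz hz, add_zero] at this
    exact this
  | inv y hy ihy =>
    have := hinv ⟨y, hy⟩
    rw [ihy hy, neg_zero] at this
    exact this
end

section
/- Let c ≥ 1, let X be a set, and let N be the free nilpotent group of class c on X, i.e., the quotient of FreeGroup X by the normal subgroup lowerCentralSeries (FreeGroup X) c, with quotient map q : FreeGroup X → N. Then for any n ≥ 1 and any t₁,…,tₙ ∈ FreeGroup X, the following are equivalent: (i) the identity of N lies in the normal subsemigroup of N generated by {q(t₁),…,q(tₙ)}; (ii) for every lattice-ordered group L whose underlying group is nilpotent of class at most c (lowerCentralSeries L c = ⊥) and which satisfies e ≤ x ⊔ (y·x⁻¹·y⁻¹) for all x,y ∈ L (i.e., L is representable), and for every group homomorphism h : FreeGroup X → L, one has e ≤ h(t₁) ⊔ ⋯ ⊔ h(tₙ). -/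
universe u
section Lat
variable {L : Type*} [Group L] [Lattice L] [MulLeftMono L] [MulRightMono L]

theorem lg_distrib (a b c : L) : a ⊓ (b ⊔ c) ≤ (a ⊓ b) ⊔ (a ⊓ c) := by
  set d := b ⊔ c with hd
  have key : ∀ x : L, x ≤ d → (a ⊓ d) * d⁻¹ * x ≤ a ⊓ x := by
    intro x hx
    have h1 : d⁻¹ * x ≤ 1 := by
      rw [inv_mul_le_iff_le_mul]; simpa using hx
    refine le_inf ?_ ?_
    · calc (a ⊓ d) * d⁻¹ * x = (a ⊓ d) * (d⁻¹ * x) := by group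
        _ ≤ a * 1 := mul_le_mul' inf_le_left h1
        _ = a := mul_one a
    · calc (a ⊓ d) * d⁻¹ * x = (a ⊓ d) * (d⁻¹ * x) := by group
        _ ≤ d * (d⁻¹ * x) := mul_le_mul_left inf_le_right _
        _ = x := by group
  calc a ⊓ d = (a ⊓ d) * d⁻¹ * (b ⊔ c) := by rw [← hd]; group
    _ = (a ⊓ d) * d⁻¹ * b ⊔ (a ⊓ d) * d⁻¹ * c := mul_sup _ _ _
    _ ≤ _ := sup_le_sup (key b le_sup_left) (key c le_sup_right)

theorem lg_orth_of (a b : L) (h : a ⊓ b ≤ 1) : (a ⊔ 1) ⊓ (b ⊔ 1) ≤ 1 := by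
  refine (lg_distrib _ _ _).trans (sup_le ?_ inf_le_right)
  rw [inf_comm]
  refine (lg_distrib _ _ _).trans (sup_le ?_ inf_le_right)
  rwa [inf_comm]

theorem lg_orth_mul {P P' Q : L} (hP : 1 ≤ P) (h : P ⊓ Q ≤ 1) (h' : P' ⊓ Q ≤ 1) :
    (P * P') ⊓ Q ≤ 1 := by
  set y := (P * P') ⊓ Q
  have h1 : P⁻¹ * y ≤ P' := by rw [inv_mul_le_iff_le_mul]; exact inf_le_left
  have h2 : P⁻¹ * y ≤ Q := by
    rw [inv_mul_le_iff_le_mul]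
    exact inf_le_right.trans (le_mul_of_one_le_left' hP)
  have h3 : P⁻¹ * y ≤ 1 := (le_inf h1 h2).trans h'
  rw [inv_mul_le_iff_le_mul, mul_one] at h3
  exact (le_inf h3 inf_le_right).trans h

theorem lg_orth_comm {P Q : L} (hP : 1 ≤ P) (hQ : 1 ≤ Q) (h : P ⊓ Q ≤ 1) : P * Q = Q * P := by
  have h1 : P ⊓ Q = 1 := le_antisymm h (le_inf hP hQ)
  have e1 : ∀ A B : L, A ⊓ B = 1 → A * B = B ⊔ A := by
    intro A B hAB
    calc A * B = A * (A ⊓ B)⁻¹ * B := by rw [hAB]; group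
      _ = _ := by rw [inv_inf, mul_sup, sup_mul]; simp
  rw [e1 P Q h1, e1 Q P (by rwa [inf_comm]), sup_comm]

theorem lg_conj_inf (g a b : L) : g * (a ⊓ b) * g⁻¹ = (g * a * g⁻¹) ⊓ (g * b * g⁻¹) := by
  rw [mul_inf, inf_mul]

theorem lg_conj_le {g a b : L} (h : a ≤ b) : g * a * g⁻¹ ≤ g * b * g⁻¹ :=
  mul_le_mul_left (mul_le_mul_right h _) _

theorem lg_conj_le_one {g a : L} (h : a ≤ 1) : g * a * g⁻¹ ≤ 1 := by
  simpa using lg_conj_le (g := g) h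

theorem lg_one_le_conj {g a : L} (h : 1 ≤ a) : 1 ≤ g * a * g⁻¹ := by
  simpa using lg_conj_le (g := g) h

theorem lg_main (hrep : ∀ x y : L, (1 : L) ≤ x ⊔ (y * x⁻¹ * y⁻¹)) (a : L)
    (S : Set L) (hS : ∀ x ∈ S, ∃ g, x ≤ g * a * g⁻¹) (h1 : (1 : L) ∈ Subsemigroup.closure S) :
    1 ≤ a := by
  set p := a ⊔ 1 with hp
  set m := a⁻¹ ⊔ 1 with hm
  have hp1 : 1 ≤ p := le_sup_right
  have hm1 : 1 ≤ m := le_sup_right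
  have hpm : ∀ g : L, p ⊓ (g * m * g⁻¹) ≤ 1 := by
    intro g
    have e : g * m * g⁻¹ = (g * a⁻¹ * g⁻¹) ⊔ 1 := by rw [hm, mul_sup, sup_mul]; simp
    rw [e]
    apply lg_orth_of
    have := hrep a⁻¹ g
    rw [← one_le_inv', inv_inf]
    simpa [mul_assoc] using this
  have hapm : a = p * m⁻¹ := by
    have : m = a⁻¹ * p := by rw [hp, hm, mul_sup]; simp [sup_comm]
    rw [this]; group
  have key : ∀ x ∈ Subsemigroup.closure S, ∃ P M : L, 1 ≤ P ∧ 1 ≤ M ∧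
      (∀ g, P ⊓ (g * m * g⁻¹) ≤ 1) ∧
      (∀ R : L, 1 ≤ R → (∀ g, R ⊓ (g * m * g⁻¹) ≤ 1) → M ⊓ R ≤ 1) ∧
      (∃ g, g * m * g⁻¹ ≤ M) ∧ x ≤ P * M⁻¹ := by
    intro x hx
    induction hx using Subsemigroup.closure_induction with
    | mem x hx =>
      obtain ⟨g, hg⟩ := hS x hx
      refine ⟨g * p * g⁻¹, g * m * g⁻¹, lg_one_le_conj hp1, lg_one_le_conj hm1, ?_, ?_,
        ⟨g, le_rfl⟩, ?_⟩
      · intro k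
        have := lg_conj_le_one (g := g) (hpm (g⁻¹ * k))
        rw [lg_conj_inf] at this
        convert this using 2
        group
      · intro R _ hR
        rw [inf_comm]; exact hR g
      · refine hg.trans (le_of_eq ?_)
        conv_lhs => rw [hapm]
        group
    | mul x y _ _ hx hy =>
      obtain ⟨P, M, hP, hM, h1, h2, ⟨g, hg⟩, h3⟩ := hx
      obtain ⟨P', M', hP', hM', h1', h2', _, h3'⟩ := hy
      refine ⟨P * P', M' * M, one_le_mul hP hP', one_le_mul hM' hM, ?_, ?_, ⟨g, ?_⟩, ?_⟩
      · intro k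
        exact lg_orth_mul hP (h1 k) (h1' k)
      · intro R hR hR'
        exact lg_orth_mul hM' (h2' R hR hR') (h2 R hR hR')
      · exact hg.trans (le_mul_of_one_le_left' hM')
      · have hc : M * P' = P' * M := lg_orth_comm hM hP' (h2 P' hP' h1')
        have hc' : M⁻¹ * P' = P' * M⁻¹ := (Commute.inv_left hc).eq
        calc x * y ≤ (P * M⁻¹) * (P' * M'⁻¹) := mul_le_mul' h3 h3'
          _ = P * (M⁻¹ * P') * M'⁻¹ := by group
          _ = P * P' * (M' * M)⁻¹ := by rw [hc']; group
  obtain ⟨P, M, hP, hM, h1, h2, ⟨g, hg⟩, h3⟩ := key 1 h1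
  have hMP : M ≤ P := by simpa using mul_le_mul_left h3 M
  have hM1 : M ≤ 1 := (le_inf le_rfl hMP).trans (h2 P hP h1)
  have : m ≤ 1 := by simpa [mul_assoc] using lg_conj_le_one (g := g⁻¹) (hg.trans hM1)
  exact inv_le_one'.mp (le_sup_left.trans this)
end Lat

section Main2
open scoped commutatorElement
section Comb
variable {G : Type*} [Group G]

/-- product of conjugates of `a` -/
def cpr (a : G) (l : List G) : G := (l.map fun g => g * a * g⁻¹).prod

@[simp] theorem cpr_nil (a : G) : cpr a [] = 1 := rfl
@[simp] theorem cpr_cons (a g : G) (l : List G) : cpr a (g :: l) = g * a * g⁻¹ * cpr a l := by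
  simp [cpr]
@[simp] theorem cpr_append (a : G) (l l' : List G) : cpr a (l ++ l') = cpr a l * cpr a l' := by
  simp [cpr]

theorem cpr_conj (a h : G) (l : List G) : cpr a (l.map (h * ·)) = h * cpr a l * h⁻¹ := by
  induction l with
  | nil => simp
  | cons g l ih => simp only [List.map_cons, cpr_cons, ih]; group

theorem cpr_cpr (a : G) (l : List G) (l' : List G) :
    cpr (cpr a l) l' = cpr a (l'.flatMap fun h => l.map (h * ·)) := by
  induction l' with
  | nil => simp
  | cons g l' ih => simp only [List.flatMap_cons, cpr_cons, cpr_append, ih, cpr_conj]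

theorem cpr_pow (a : G) (l : List G) (k : ℕ) :
    cpr a l ^ k = cpr a (List.replicate k l).flatten := by
  induction k with
  | zero => simp
  | succ k ih => rw [pow_succ', ih, List.replicate_succ, List.flatten_cons, cpr_append]

theorem cpr_map {H : Type*} [Group H] (f : G →* H) (a : G) (l : List G) :
    f (cpr a l) = cpr (f a) (l.map f) := by
  induction l with
  | nil => simp
  | cons g l ih => simp [ih]

theorem cpr_mul_central (a z : G) (hz : z ∈ Subgroup.center G) (l : List G) :
    cpr (a * z) l = cpr a l * z ^ l.length := by
  rw [Subgroup.mem_center_iff] at hz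
  have hz' : ∀ g, Commute z g := fun g => (hz g).symm
  induction l with
  | nil => simp
  | cons g l ih =>
    simp only [cpr_cons, ih, List.length_cons, pow_succ']
    have e : g * (a * z) * g⁻¹ = g * a * g⁻¹ * z := by
      simp only [mul_assoc, (hz' g⁻¹).eq]
    rw [e]
    calc g * a * g⁻¹ * z * (cpr a l * z ^ l.length)
        = g * a * g⁻¹ * (z * cpr a l) * z ^ l.length := by group
      _ = _ := by rw [(hz' _).eq]; group

theorem cpr_central (a : G) (hz : a ∈ Subgroup.center G) (l : List G) :
    cpr a l = a ^ l.length := by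
  have h1 : ∀ l : List G, cpr (1 : G) l = 1 := by
    intro l; induction l with
    | nil => simp
    | cons g l ih => simp [ih]
  simpa [h1] using cpr_mul_central 1 a hz l

theorem malcev (a : G) (i : ℕ) (l₁ l₂ : List G) :
    ∃ p q : List G, cpr a (l₁ ++ p) * (cpr a (l₂ ++ q))⁻¹ ∈
      Subgroup.lowerCentralSeries (⊤ : Subgroup G) i ∧
      (l₁.length = l₂.length → p.length = q.length ∧ p.length = (2 ^ i - 1) * l₁.length) := by
  induction i with
  | zero => exact ⟨[], [], by simp, by simp⟩
  | succ i ih =>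
    obtain ⟨p, q, h, hl⟩ := ih
    refine ⟨p ++ (l₂ ++ q), q ++ (l₁ ++ p), ?_, ?_⟩
    · rw [Subgroup.lowerCentralSeries_succ]
      have := Subgroup.commutator_mem_commutator h (Subgroup.mem_top (cpr a (l₂ ++ q)))
      convert this using 1
      simp only [← List.append_assoc, commutatorElement_def]
      rw [List.append_assoc (l₁ ++ p), cpr_append _ (l₁ ++ p), List.append_assoc (l₂ ++ q), cpr_append _ (l₂ ++ q)]
      group
    · intro hh
      obtain ⟨h1, h2⟩ := hl hh
      simp only [List.length_append]
      refine ⟨by omega, ?_⟩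
      rw [← h1, h2, ← hh]
      have : 2 ^ (i+1) - 1 = (2 ^ i - 1) + 1 + (2 ^ i - 1) := by
        have := Nat.one_le_two_pow (n := i)
        rw [pow_succ]; omega
      rw [this]; ring

theorem malcev' {c : ℕ} (hG : Subgroup.lowerCentralSeries (⊤ : Subgroup G) c = ⊥)
    (a : G) (l₁ l₂ : List G) :
    ∃ p q : List G, cpr a l₁ * cpr a p = cpr a l₂ * cpr a q ∧
      (l₁.length = l₂.length → p.length = q.length ∧ p.length = (2 ^ c - 1) * l₁.length) := by
  obtain ⟨p, q, h, hl⟩ := malcev a c l₁ l₂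
  rw [hG, Subgroup.mem_bot, mul_inv_eq_one] at h
  exact ⟨p, q, by simpa using h, hl⟩

theorem ore {c : ℕ} (hG : Subgroup.lowerCentralSeries (⊤ : Subgroup G) c = ⊥)
    (a v : G) (hv : v ∈ Subgroup.normalClosure {a}) :
    ∃ l l' : List G, l ≠ [] ∧ v = cpr a l * (cpr a l')⁻¹ := by
  suffices h : ∃ l l' : List G, v = cpr a l * (cpr a l')⁻¹ by
    obtain ⟨l, l', h⟩ := h
    exact ⟨l ++ [1], l' ++ [1], by simp, by simp [h]⟩
  unfold Subgroup.normalClosure at hv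
  induction hv using Subgroup.closure_induction with
  | mem x hx =>
    rw [Group.mem_conjugatesOfSet_iff] at hx
    obtain ⟨b, hb, hx⟩ := hx
    obtain rfl : b = a := hb
    obtain ⟨g, hg⟩ := isConj_iff.mp hx
    exact ⟨[g], [], by simp [hg]⟩
  | one => exact ⟨[], [], by simp⟩
  | inv x _ hx =>
    obtain ⟨l, l', rfl⟩ := hx
    exact ⟨l', l, by simp⟩
  | mul x y _ _ hx hy =>
    obtain ⟨s, t, rfl⟩ := hx
    obtain ⟨s', t', rfl⟩ := hy
    obtain ⟨p, q, h, -⟩ := malcev' hG a t s'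
    refine ⟨s ++ p, t' ++ q, ?_⟩
    have : (cpr a t)⁻¹ * cpr a s' = cpr a p * (cpr a q)⁻¹ := by
      rw [inv_mul_eq_iff_eq_mul, ← mul_assoc, h]; group
    simp only [cpr_append]
    calc _ = cpr a s * ((cpr a t)⁻¹ * cpr a s') * (cpr a t')⁻¹ := by group
      _ = _ := by rw [this]; group

theorem comm_pow_right (v g : G) (h : ⁅v, g⁆ ∈ Subgroup.center G) (m : ℕ) :
    ⁅v, g⁆ ^ m = ⁅v, g ^ m⁆ := by
  rw [Subgroup.mem_center_iff] at h
  induction m with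
  | zero => simp
  | succ m ih =>
    rw [pow_succ', pow_succ', ih, commutatorElement_mul_right_eq_mul_conj, ← ih]
    have : ⁅v, g⁆ ^ m * g⁻¹ = g⁻¹ * ⁅v, g⁆ ^ m := by
      have h2 : Commute ⁅v, g⁆ g⁻¹ := (h g⁻¹).symm
      exact (h2.pow_left m).eq
    simp [mul_assoc, this]

theorem comm_pow_left (v g : G) (h : ⁅v, g⁆ ∈ Subgroup.center G) (m : ℕ) :
    ⁅v, g⁆ ^ m = ⁅v ^ m, g⁆ := by
  have := comm_pow_right g v (by rw [← commutatorElement_inv]; exact inv_mem h) m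
  rw [← commutatorElement_inv v g, ← commutatorElement_inv (v ^ m) g, inv_pow, inv_inj] at this
  exact this

theorem lemB_s15 {c : ℕ} (hG : Subgroup.lowerCentralSeries (⊤ : Subgroup G) c = ⊥)
    (u : G) (K : Subgroup G) (hK : K ≤ Subgroup.normalClosure {u})
    (hc : ⁅K, (⊤ : Subgroup G)⁆ ≤ Subgroup.center G) (w : G) (hw : w ∈ ⁅K, (⊤ : Subgroup G)⁆) :
    ∃ N, 1 ≤ N ∧ ∀ m : ℕ, ∃ l l' : List G, l.length = N ∧ l'.length = N ∧
      w ^ m * cpr u l = cpr u l' := by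
  rw [Subgroup.commutator_def] at hw
  induction hw using Subgroup.closure_induction with
  | mem x hx =>
    obtain ⟨v, hv, g, -, rfl⟩ := hx
    obtain ⟨s, t, hs, e⟩ := ore hG u v (hK hv)
    refine ⟨s.length + (2 ^ c - 1) * t.length, ?_, fun m => ?_⟩
    · have := List.length_pos_iff.mpr hs; omega
    · obtain ⟨p, q, h, hl⟩ := malcev' hG u t (t.map (g ^ m * ·))
      obtain ⟨h1, h2⟩ := hl (by simp)
      refine ⟨s.map (g ^ m * ·) ++ q, s ++ p, by simp [← h1, h2], by simp [h2], ?_⟩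
      rw [comm_pow_right v g (hc (Subgroup.commutator_mem_commutator hv (Subgroup.mem_top g))),
        commutatorElement_def, e]
      simp only [cpr_append, cpr_conj] at h ⊢
      have h' : cpr u p = (cpr u t)⁻¹ * (g ^ m * cpr u t * (g ^ m)⁻¹ * cpr u q) := by
        rw [← h]; group
      rw [h']; group
  | one => exact ⟨1, le_rfl, fun m => ⟨[1], [1], by simp, by simp, by simp⟩⟩
  | inv x _ hx =>
    obtain ⟨N, hN, h⟩ := hx
    refine ⟨N, hN, fun m => ?_⟩
    obtain ⟨l, l', h1, h2, h3⟩ := h m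
    exact ⟨l', l, h2, h1, by rw [← h3]; group⟩
  | mul x y hx' hy' hx hy =>
    obtain ⟨N, hN, h⟩ := hx
    obtain ⟨N', hN', h'⟩ := hy
    refine ⟨N + N', by omega, fun m => ?_⟩
    obtain ⟨l, l', h1, h2, h3⟩ := h m
    obtain ⟨k, k', h1', h2', h3'⟩ := h' m
    refine ⟨l ++ k, l' ++ k', by simp [h1, h1'], by simp [h2, h2'], ?_⟩
    have hy : ∀ g, Commute y g := fun g => ((Subgroup.mem_center_iff.mp (hc hy')) g).symm
    rw [cpr_append, cpr_append, ← h3, ← h3', (hy x).symm.mul_pow]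
    have := ((hy (cpr u l)).pow_left m).eq
    calc _ = x ^ m * (y ^ m * cpr u l) * cpr u k := by group
      _ = _ := by rw [this]; group

/-- the relative lower central series of the normal closure of `a` -/
def rk (a : G) : ℕ → Subgroup G
  | 0 => Subgroup.normalClosure {a}
  | n + 1 => ⁅rk a n, (⊤ : Subgroup G)⁆

instance rk_normal (a : G) (n : ℕ) : (rk a n).Normal := by
  cases n with
  | zero => unfold rk; infer_instance
  | succ n =>
    have : (rk a n).Normal := rk_normal a n
    unfold rk; infer_instance

theorem rk_le (a : G) (n : ℕ) : rk a n ≤ Subgroup.normalClosure {a} := by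
  induction n with
  | zero => exact le_rfl
  | succ n ih => exact (Subgroup.commutator_le_left _ _).trans ih

theorem rk_le_lcs (a : G) (n : ℕ) : rk a n ≤ Subgroup.lowerCentralSeries (⊤ : Subgroup G) n := by
  induction n with
  | zero => exact le_top
  | succ n ih => exact Subgroup.commutator_mono ih le_rfl

theorem rk_mono {a b : G} (h : a ∈ Subgroup.normalClosure {b}) (n : ℕ) : rk a n ≤ rk b n := by
  induction n with
  | zero =>
    have h' : ({a} : Set G) ⊆ (Subgroup.normalClosure {b} : Subgroup G) := by simpa using h
    exact Subgroup.normalClosure_le_normal h'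
  | succ n ih => exact Subgroup.commutator_mono ih le_rfl

theorem rk_map {H : Type*} [Group H] (f : G →* H) (hf : Function.Surjective f) (a : G) (n : ℕ) :
    (rk a n).map f = rk (f a) n := by
  induction n with
  | zero => unfold rk; rw [Subgroup.map_normalClosure _ _ hf]; simp
  | succ n ih =>
    change Subgroup.map f ⁅rk a n, ⊤⁆ = ⁅rk (f a) n, ⊤⁆
    rw [Subgroup.map_commutator, ih, Subgroup.map_top_of_surjective f hf]

theorem cpr_mem (a : G) (l : List G) : cpr a l ∈ Subgroup.normalClosure {a} := by
  induction l with
  | nil => exact one_mem _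
  | cons g l ih =>
    rw [cpr_cons]
    exact mul_mem (Subgroup.normalClosure_normal.conj_mem _
      (Subgroup.subset_normalClosure (by simp)) g) ih

end Comb

theorem rk_pow (j : ℕ) : ∀ {G : Type*} [Group G] (a : G) (_ : rk a (j + 1) = ⊥) (l : List G)
    (z : G) (_ : z ∈ rk a j), z ^ l.length ∈ rk (cpr a l) j := by
  induction j with
  | zero =>
    intro G _ a h l z hz
    have hc : rk a 0 ≤ Subgroup.center G := Subgroup.commutator_top_right_eq_bot_iff_le_center.mp h
    have ha : a ∈ Subgroup.center G := hc (Subgroup.subset_normalClosure (by simp))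
    rw [cpr_central a ha]
    have h2 : Subgroup.normalClosure {a} ≤ Subgroup.zpowers a := by
      have : (Subgroup.zpowers a).Normal := by
        constructor
        rintro _ ⟨n, rfl⟩ g
        have h3 := (Subgroup.mem_center_iff.mp (zpow_mem ha n)) g
        simp only [h3]
        simp
      exact Subgroup.normalClosure_le_normal (by simp)
    obtain ⟨n, rfl⟩ := h2 hz
    have : (a ^ n) ^ l.length = (a ^ l.length) ^ n := by
      rw [← zpow_natCast, ← zpow_natCast, ← zpow_mul, ← zpow_mul, mul_comm]
    simp only [this]
    exact zpow_mem (Subgroup.subset_normalClosure (by simp)) n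
  | succ j ih =>
    intro G _ a h l z hz
    have hc : rk a (j+1) ≤ Subgroup.center G :=
      Subgroup.commutator_top_right_eq_bot_iff_le_center.mp h
    have hz' := hz
    change z ∈ ⁅rk a j, ⊤⁆ at hz'
    rw [Subgroup.commutator_def] at hz'
    induction hz' using Subgroup.closure_induction with
    | mem x hx =>
      obtain ⟨v, hv, g, -, rfl⟩ := hx
      let f := QuotientGroup.mk' (rk a (j+1))
      have hf : Function.Surjective f := QuotientGroup.mk'_surjective _
      have h1 : rk (f a) (j + 1) = ⊥ := by
        rw [← rk_map f hf, Subgroup.map_eq_bot_iff, QuotientGroup.ker_mk']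
      have h2 := ih (f a) h1 (l.map f) (f v) (by rw [← rk_map f hf]; exact ⟨v, hv, rfl⟩)
      rw [← cpr_map, ← rk_map f hf, List.length_map] at h2
      obtain ⟨v', hv', e⟩ := h2
      rw [← map_pow] at e
      have e1 : v'⁻¹ * v ^ l.length ∈ rk a (j+1) := by
        have := QuotientGroup.eq.mp e
        exact this
      set y := v'⁻¹ * v ^ l.length with hy
      have e2 : v ^ l.length = v' * y := by rw [hy]; group
      have hyc := Subgroup.mem_center_iff.mp (hc e1)
      rw [comm_pow_left v g (hc hz), e2]
      have : ⁅v' * y, g⁆ = ⁅v', g⁆ := by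
        rw [commutatorElement_def, commutatorElement_def]
        have : y * g * (v' * y)⁻¹ = g * v'⁻¹ := by
          rw [← hyc g]; group
        calc _ = v' * (y * g * (v' * y)⁻¹) * g⁻¹ := by group
          _ = _ := by rw [this]; group
      rw [this]
      exact Subgroup.commutator_mem_commutator hv' (Subgroup.mem_top g)
    | one => simp [one_mem]
    | inv x hx' hx =>
      rw [inv_pow]; exact inv_mem (hx hx')
    | mul x y hx' hy' hx hy =>
      have : Commute x y := (Subgroup.mem_center_iff.mp (hc hy') x)
      rw [this.mul_pow]
      exact mul_mem (hx hx') (hy hy')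

theorem keyL (c d : ℕ) : ∀ {G : Type*} [Group G]
    (_ : Subgroup.lowerCentralSeries (⊤ : Subgroup G) c = ⊥) (a : G) (_ : rk a (d + 1) = ⊥)
    (l₁ l₂ : List G) (_ : l₁ ≠ []) (_ : l₂ ≠ []),
    ∃ m₁ m₂ : List G, m₁ ≠ [] ∧ m₂ ≠ [] ∧ cpr (cpr a l₁) m₁ = cpr (cpr a l₂) m₂ := by
  induction d with
  | zero =>
    intro G _ hG a h l₁ l₂ h1 h2
    have hc : rk a 0 ≤ Subgroup.center G := Subgroup.commutator_top_right_eq_bot_iff_le_center.mp h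
    have ha : a ∈ Subgroup.center G := hc (Subgroup.subset_normalClosure (by simp))
    have h1' := List.length_pos_iff.mpr h1
    have h2' := List.length_pos_iff.mpr h2
    refine ⟨List.replicate l₂.length 1, List.replicate l₁.length 1, ?_, ?_, ?_⟩
    · simpa using h2
    · simpa using h1
    · rw [cpr_central a ha, cpr_central a ha, cpr_central _ (pow_mem ha _),
        cpr_central _ (pow_mem ha _)]
      simp only [List.length_replicate, ← pow_mul, mul_comm]
  | succ d ih =>
    intro G _ hG a h l₁ l₂ h1 h2
    have hc : rk a (d+1) ≤ Subgroup.center G :=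
      Subgroup.commutator_top_right_eq_bot_iff_le_center.mp h
    let f := QuotientGroup.mk' (rk a (d+1))
    have hf : Function.Surjective f := QuotientGroup.mk'_surjective _
    have hfa : rk (f a) (d + 1) = ⊥ := by
      rw [← rk_map f hf, Subgroup.map_eq_bot_iff, QuotientGroup.ker_mk']
    have hGf : Subgroup.lowerCentralSeries (⊤ : Subgroup (G ⧸ rk a (d+1))) c = ⊥ := by
      rw [← Subgroup.map_top_of_surjective f hf, ← Subgroup.map_lowerCentralSeries, hG,
        Subgroup.map_bot]
    obtain ⟨n₁, n₂, hn1, hn2, e⟩ := ih hGf (f a) hfa (l₁.map f) (l₂.map f) (by simpa using h1)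
      (by simpa using h2)
    obtain ⟨m₁, rfl⟩ := (List.map_surjective_iff.mpr hf) n₁
    obtain ⟨m₂, rfl⟩ := (List.map_surjective_iff.mpr hf) n₂
    rw [← cpr_map, ← cpr_map, ← cpr_map, ← cpr_map] at e
    have hz : (cpr (cpr a l₁) m₁)⁻¹ * cpr (cpr a l₂) m₂ ∈ rk a (d+1) := QuotientGroup.eq.mp e
    set u := cpr (cpr a l₁) m₁ with hu
    set v := cpr (cpr a l₂) m₂ with hv
    set z := u⁻¹ * v with hzdef
    have hvz : v = u * z := by rw [hzdef]; group
    have hum : u ∈ Subgroup.normalClosure {a} := by rw [hu, cpr_cpr]; exact cpr_mem _ _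
    have hzk : ∃ k : ℕ, 1 ≤ k ∧ z ^ k ∈ rk u (d+1) := by
      refine ⟨(m₁.flatMap fun h => l₁.map (h * ·)).length, ?_, ?_⟩
      rotate_left
      · rw [hu, cpr_cpr]
        exact rk_pow (d+1) a h _ z hz
      · obtain ⟨x, l₁, rfl⟩ := List.exists_cons_of_ne_nil h1
        obtain ⟨y, m₁, rfl⟩ := List.exists_cons_of_ne_nil (l := m₁) (by simpa using hn1)
        simp
    obtain ⟨k, hk, hzk⟩ := hzk
    obtain ⟨N, hN, hB⟩ := lemB_s15 hG u (rk u d) (rk_le u d) ((rk_mono hum (d+1)).trans hc) (z ^ k) hzk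
    obtain ⟨r, s, hr, hs, hrs⟩ := hB N
    have hzc := hc hz
    have hcz : ∀ g, Commute z g := fun g => ((Subgroup.mem_center_iff.mp hzc) g).symm
    have main : cpr v (List.replicate k r).flatten =
        cpr u ((List.replicate (k-1) r).flatten ++ s) := by
      rw [← cpr_pow, cpr_append, ← cpr_pow, ← hrs, hvz, cpr_mul_central _ _ hzc, hr]
      obtain ⟨k, rfl⟩ : ∃ k', k = k' + 1 := ⟨k - 1, by omega⟩
      have c1 : Commute (cpr u r) (z ^ N) := ((hcz (cpr u r)).pow_left N).symm
      rw [c1.mul_pow, ← pow_mul, ← pow_mul, Nat.add_sub_cancel, mul_comm N,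
        ((hcz (cpr u r)).pow_left _).eq, pow_succ]
      group
    refine ⟨(((List.replicate (k-1) r).flatten ++ s).flatMap fun h => m₁.map (h * ·)),
      (((List.replicate k r).flatten).flatMap fun h => m₂.map (h * ·)), ?_, ?_, ?_⟩
    · have : m₁ ≠ [] := by simpa using hn1
      have h' : s ≠ [] := by rw [← List.length_pos_iff]; omega
      obtain ⟨x, s, rfl⟩ := List.exists_cons_of_ne_nil h'
      simp [this]
    · have : m₂ ≠ [] := by simpa using hn2
      have h' : r ≠ [] := by rw [← List.length_pos_iff]; omega
      obtain ⟨x, r, rfl⟩ := List.exists_cons_of_ne_nil h'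
      obtain ⟨k, rfl⟩ : ∃ k', k = k' + 1 := ⟨k - 1, by omega⟩
      simp [this, List.replicate_succ]
    · rw [← cpr_cpr, ← cpr_cpr, ← hu, ← hv, main]

end Main2

section Zorn
variable {G : Type*} [Group G]

theorem cpr_inv (a : G) (l : List G) : (cpr a l)⁻¹ = cpr a⁻¹ l.reverse := by
  induction l with
  | nil => simp
  | cons g l ih => simp [ih, mul_assoc]

theorem exists_total {c : ℕ} (hG : Subgroup.lowerCentralSeries (⊤ : Subgroup G) c = ⊥)
    (S : Subsemigroup G) (hS : ∀ g x, x ∈ S → g * x * g⁻¹ ∈ S) (h1 : (1 : G) ∉ S) :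
    ∃ M : Submonoid G, (∀ g x, x ∈ M → g * x * g⁻¹ ∈ M) ∧ (∀ x ∈ M, x ∉ S) ∧
      ∀ a, a ∈ M ∨ a⁻¹ ∈ M := by
  obtain ⟨M, hM⟩ := zorn_le₀ {M : Submonoid G | (∀ g x, x ∈ M → g * x * g⁻¹ ∈ M) ∧
    (∀ x ∈ M, x ∉ S)} (by
      intro C hC hchain
      rcases C.eq_empty_or_nonempty with rfl | hne
      · refine ⟨⊥, ⟨?_, ?_⟩, by simp⟩
        · intro g x hx
          rw [Submonoid.mem_bot] at hx ⊢
          simp [hx]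
        · intro x hx
          rw [Submonoid.mem_bot] at hx
          rwa [hx]
      · have hd := hchain.directedOn
        refine ⟨sSup C, ⟨?_, ?_⟩, fun z hz => le_sSup hz⟩
        · intro g x hx
          rw [Submonoid.mem_sSup_of_directedOn hne hd] at hx ⊢
          obtain ⟨s, hs, hx⟩ := hx
          exact ⟨s, hs, (hC hs).1 g x hx⟩
        · intro x hx
          rw [Submonoid.mem_sSup_of_directedOn hne hd] at hx
          obtain ⟨s, hs, hx⟩ := hx
          exact (hC hs).2 x hx)
  obtain ⟨⟨hMn, hMS⟩, hmax⟩ := hM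
  refine ⟨M, hMn, hMS, ?_⟩
  have ext : ∀ a, a ∉ M → ∃ m ∈ M, ∃ l, l ≠ [] ∧ m * cpr a l ∈ S := by
    intro a ha
    by_contra hcon
    push Not at hcon
    let M' : Submonoid G :=
      { carrier := {x | ∃ m ∈ M, ∃ l, x = m * cpr a l}
        one_mem' := ⟨1, one_mem _, [], by simp⟩
        mul_mem' := by
          rintro _ _ ⟨m, hm, l, rfl⟩ ⟨m', hm', l', rfl⟩
          refine ⟨m * m', mul_mem hm hm', l.map (m'⁻¹ * ·) ++ l', ?_⟩
          rw [cpr_append, cpr_conj]; group }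
    have hle : M ≤ M' := fun m hm => ⟨m, hm, [], by simp⟩
    have haM' : a ∈ M' := ⟨1, one_mem _, [1], by simp⟩
    refine ha (hmax (y := M') ⟨?_, ?_⟩ hle haM')
    · rintro g _ ⟨m, hm, l, rfl⟩
      refine ⟨g * m * g⁻¹, hMn g m hm, l.map (g * ·), ?_⟩
      rw [cpr_conj]; group
    · rintro _ ⟨m, hm, l, rfl⟩
      by_cases hl : l = []
      · subst hl; simpa using hMS m hm
      · exact hcon m hm l hl
  have Qmul : ∀ x y, (∃ m ∈ M, m * x ∈ S) → (∃ m ∈ M, m * y ∈ S) → ∃ m ∈ M, m * (x * y) ∈ S := by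
    rintro x y ⟨m, hm, hx⟩ ⟨m', hm', hy⟩
    refine ⟨m * (x * m' * x⁻¹), mul_mem hm (hMn x m' hm'), ?_⟩
    have := mul_mem hx hy
    convert this using 1
    group
  have Qcpr : ∀ x, (∃ m ∈ M, m * x ∈ S) → ∀ l, l ≠ [] → ∃ m ∈ M, m * cpr x l ∈ S := by
    rintro x ⟨m, hm, hx⟩ l hl
    have hconj : ∀ g, ∃ m ∈ M, m * (g * x * g⁻¹) ∈ S := fun g =>
      ⟨g * m * g⁻¹, hMn g m hm, by
        have := hS g _ hx
        convert this using 1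
        group⟩
    induction l with
    | nil => exact absurd rfl hl
    | cons g l ih =>
      by_cases h : l = []
      · subst h; simpa using hconj g
      · rw [cpr_cons]
        exact Qmul _ _ (hconj g) (ih h)
  intro a
  by_contra hcon
  push Not at hcon
  obtain ⟨ha, ha'⟩ := hcon
  obtain ⟨m, hm, l, hl, hx⟩ := ext a ha
  obtain ⟨m', hm', l', hl', hy⟩ := ext a⁻¹ ha'
  have hrk : rk a (c + 1) = ⊥ := by
    rw [eq_bot_iff, ← hG]
    exact (rk_le_lcs a (c+1)).trans (Subgroup.lowerCentralSeries_antitone _ (Nat.le_succ c))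
  obtain ⟨m₁, m₂, h1', h2', e⟩ := keyL c c hG a hrk l l'.reverse hl (by simpa using hl')
  have q1 := Qcpr (cpr a l) ⟨m, hm, hx⟩ m₁ h1'
  have q2 := Qcpr (cpr a⁻¹ l') ⟨m', hm', hy⟩ m₂.reverse (by simpa using h2')
  have e2 : cpr (cpr a⁻¹ l') m₂.reverse = (cpr (cpr a l) m₁)⁻¹ := by
    rw [e, cpr_inv, cpr_inv, List.reverse_reverse]
  rw [e2] at q2
  obtain ⟨n, hn, hnS⟩ := Qmul _ _ q1 q2
  simp only [mul_inv_cancel, mul_one] at hnS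
  exact hMS n hn hnS

end Zorn

theorem order_quot {G : Type u} [Group G] (M : Submonoid G) (hM : ∀ g x, x ∈ M → g * x * g⁻¹ ∈ M)
    (htot : ∀ a, a ∈ M ∨ a⁻¹ ∈ M) :
    ∃ (T : Subgroup G) (_ : T.Normal) (_ : LinearOrder (G ⧸ T)), (∀ x ∈ T, x ∈ M) ∧
      (∀ x, x ∈ M → x⁻¹ ∈ M → x ∈ T) ∧
      (∀ a b c : G ⧸ T, a ≤ b → c * a ≤ c * b) ∧ (∀ a b c : G ⧸ T, a ≤ b → a * c ≤ b * c) ∧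
      ∀ x : G, (1 : G ⧸ T) ≤ QuotientGroup.mk' T x ↔ x ∈ M := by
  classical
  let T : Subgroup G :=
    { carrier := {x | x ∈ M ∧ x⁻¹ ∈ M}
      one_mem' := ⟨one_mem _, by simp [one_mem]⟩
      mul_mem' := by
        rintro x y ⟨h1, h2⟩ ⟨h3, h4⟩
        exact ⟨mul_mem h1 h3, by rw [mul_inv_rev]; exact mul_mem h4 h2⟩
      inv_mem' := by
        rintro x ⟨h1, h2⟩
        exact ⟨h2, by simpa using h1⟩ }
  have hT : T.Normal := by
    constructor
    rintro x ⟨h1, h2⟩ g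
    refine ⟨hM g x h1, ?_⟩
    have := hM g _ h2
    convert this using 1
    group
  let f := QuotientGroup.mk' T
  have hf : Function.Surjective f := QuotientGroup.mk'_surjective _
  have hmem : ∀ x, f x ∈ M.map f ↔ x ∈ M := by
    intro x
    constructor
    · rintro ⟨y, hy, e⟩
      have : y⁻¹ * x ∈ T := QuotientGroup.eq.mp e
      simpa using mul_mem hy this.1
    · intro h; exact ⟨x, h, rfl⟩
  let C := M.map f
  have hCn : ∀ g x, x ∈ C → g * x * g⁻¹ ∈ C := by
    intro g x hx
    obtain ⟨g, rfl⟩ := hf g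
    obtain ⟨x, hx, rfl⟩ := hx
    exact ⟨g * x * g⁻¹, hM g x hx, by simp⟩
  let ord : LinearOrder (G ⧸ T) :=
    { le := fun a b => a⁻¹ * b ∈ C
      le_refl := fun a => by
        change a⁻¹ * a ∈ C
        simp [one_mem]
      le_trans := fun a b d h1 h2 => by
        change a⁻¹ * d ∈ C
        have := mul_mem h1 h2
        convert this using 1
        group
      le_antisymm := fun a b h1 h2 => by
        obtain ⟨a, rfl⟩ := hf a
        obtain ⟨b, rfl⟩ := hf b
        change (f a)⁻¹ * f b ∈ C at h1
        change (f b)⁻¹ * f a ∈ C at h2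
        rw [← map_inv, ← map_mul] at h1 h2
        have h1' := (hmem _).mp h1
        have h2' := (hmem _).mp h2
        exact QuotientGroup.eq.mpr ⟨h1', by simpa using h2'⟩
      le_total := fun a b => by
        obtain ⟨a, rfl⟩ := hf a
        obtain ⟨b, rfl⟩ := hf b
        change (f a)⁻¹ * f b ∈ C ∨ (f b)⁻¹ * f a ∈ C
        rw [← map_inv, ← map_mul, ← map_inv, ← map_mul]
        rcases htot (a⁻¹ * b) with h | h
        · exact Or.inl ((hmem _).mpr h)
        · exact Or.inr ((hmem _).mpr (by simpa using h))
      toDecidableLE := Classical.decRel _ }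
  refine ⟨T, hT, ord, fun x hx => hx.1, fun x h1 h2 => ⟨h1, h2⟩, ?_, ?_, ?_⟩
  · intro a b d h
    change (d * a)⁻¹ * (d * b) ∈ C
    have h : a⁻¹ * b ∈ C := h
    convert h using 1
    group
  · intro a b d h
    change (a * d)⁻¹ * (b * d) ∈ C
    have h : a⁻¹ * b ∈ C := h
    have := hCn d⁻¹ _ h
    convert this using 1
    group
  · intro x
    change (1 : G ⧸ T)⁻¹ * f x ∈ C ↔ _
    rw [inv_one, one_mul]
    exact hmem x

theorem finite_supp {X : Type*} [DecidableEq X] (t : FreeGroup X) :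
    ∃ F : Finset X, ∀ F' : Finset X, F ⊆ F' →
      FreeGroup.lift (fun x => if x ∈ F' then FreeGroup.of x else 1) t = t := by
  induction t using FreeGroup.induction_on with
  | C1 => exact ⟨∅, fun _ _ => by simp⟩
  | of x => exact ⟨{x}, fun F' h => by
      have : x ∈ F' := h (by simp)
      simp [this]⟩
  | inv_of x ih =>
    obtain ⟨F, hF⟩ := ih
    exact ⟨F, fun F' h => by rw [map_inv, hF F' h]⟩
  | mul x y hx hy =>
    obtain ⟨F, hF⟩ := hx
    obtain ⟨F₂, hF₂⟩ := hy
    exact ⟨F ∪ F₂, fun F' h => by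
      rw [map_mul, hF F' (Finset.union_subset_left h), hF₂ F' (Finset.union_subset_right h)]⟩

theorem factor_small {X : Type*} (n : ℕ) (t : Fin n → FreeGroup X) :
    ∃ (Y : Type u) (ι : FreeGroup Y →* FreeGroup X) (ψ : FreeGroup X →* FreeGroup Y),
      ∀ i, ι (ψ (t i)) = t i := by
  classical
  choose F hF using fun i => finite_supp (t i)
  let A : Finset X := Finset.univ.biUnion F
  let e := A.equivFin
  refine ⟨ULift.{u} (Fin A.card), FreeGroup.lift fun y => FreeGroup.of ((e.symm y.down : A) : X),
    FreeGroup.lift fun x => if h : x ∈ A then FreeGroup.of ⟨e ⟨x, h⟩⟩ else 1, fun i => ?_⟩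
  conv_rhs => rw [← hF i A (Finset.subset_biUnion_of_mem F (Finset.mem_univ i))]
  rw [← MonoidHom.comp_apply]
  congr 1
  ext x
  by_cases h : x ∈ A <;> simp [h]

theorem stmt15 {X : Type*} (c : ℕ) (hc : 1 ≤ c)
    (n : ℕ) (hn : 0 < n) (t : Fin n → FreeGroup X) :
    ((1 : FreeGroup X ⧸ Subgroup.lowerCentralSeries (⊤ : Subgroup (FreeGroup X)) c) ∈
        Subsemigroup.closure
          {x : FreeGroup X ⧸ Subgroup.lowerCentralSeries (⊤ : Subgroup (FreeGroup X)) c |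
            ∃ i : Fin n, ∃ g : FreeGroup X ⧸ Subgroup.lowerCentralSeries (⊤ : Subgroup (FreeGroup X)) c,
              x = g * (QuotientGroup.mk' (Subgroup.lowerCentralSeries (⊤ : Subgroup (FreeGroup X)) c) (t i)) * g⁻¹}) ↔
      ∀ (L : Type u) [Group L] [Lattice L]
        [CovariantClass L L (· * ·) (· ≤ ·)]
        [CovariantClass L L (Function.swap (· * ·)) (· ≤ ·)],
        Subgroup.lowerCentralSeries (⊤ : Subgroup L) c = ⊥ →
        (∀ x y : L, (1 : L) ≤ x ⊔ (y * x⁻¹ * y⁻¹)) →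
        ∀ h : FreeGroup X →* L,
          (1 : L) ≤ Finset.univ.sup' ⟨⟨0, hn⟩, Finset.mem_univ _⟩ fun i => h (t i) := by
  set N := FreeGroup X ⧸ Subgroup.lowerCentralSeries (⊤ : Subgroup (FreeGroup X)) c with hN
  set q := QuotientGroup.mk' (Subgroup.lowerCentralSeries (⊤ : Subgroup (FreeGroup X)) c) with hq
  have hqs : Function.Surjective q := QuotientGroup.mk'_surjective _
  set A : Set N := {x : N | ∃ i : Fin n, ∃ g : N, x = g * q (t i) * g⁻¹} with hA
  constructor
  · intro h1 L _ _ _ _ hnil hrep h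
    have hL : MulLeftMono L := ‹CovariantClass L L (· * ·) (· ≤ ·)›
    have hR : MulRightMono L := ‹CovariantClass L L (Function.swap (· * ·)) (· ≤ ·)›
    have hker : Subgroup.lowerCentralSeries (⊤ : Subgroup (FreeGroup X)) c ≤ h.ker := by
      rw [← Subgroup.map_eq_bot_iff, eq_bot_iff, ← hnil, Subgroup.map_lowerCentralSeries]
      exact Subgroup.lowerCentralSeries_mono c le_top
    let k : N →* L := QuotientGroup.lift _ h hker
    have hk : ∀ x, k (q x) = h x := fun x => rfl
    refine lg_main hrep _ (k '' A) ?_ ?_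
    · rintro _ ⟨_, ⟨i, g, rfl⟩, rfl⟩
      refine ⟨k g, ?_⟩
      rw [map_mul, map_mul, map_inv, hk]
      exact lg_conj_le (Finset.le_sup' (fun i => h (t i)) (Finset.mem_univ i))
    · have : k 1 ∈ (Subsemigroup.closure A).map (k : N →ₙ* L) := ⟨1, h1, rfl⟩
      rw [MulHom.map_mclosure, map_one] at this
      exact this
  · intro H
    by_contra h1
    have hNil : Subgroup.lowerCentralSeries (⊤ : Subgroup N) c = ⊥ := by
      rw [← Subgroup.map_top_of_surjective q hqs, ← Subgroup.map_lowerCentralSeries,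
        Subgroup.map_eq_bot_iff, hq, QuotientGroup.ker_mk']
    obtain ⟨M, hMn, hMS, htot⟩ := exists_total hNil (Subsemigroup.closure A) (by
      intro g x hx
      induction hx using Subsemigroup.closure_induction with
      | mem x hx =>
        obtain ⟨i, g', rfl⟩ := hx
        exact Subsemigroup.subset_closure ⟨i, g * g', by group⟩
      | mul x y _ _ hx hy =>
        have := mul_mem hx hy
        convert this using 1
        group) h1
    obtain ⟨Y, ι, ψ, hψ⟩ := factor_small.{u} n t
    obtain ⟨T, hT, ord, hTM, hMT, hl, hr, hpos⟩ := order_quot (M.comap (q.comp ι))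
      (by
        intro g x hx
        rw [Submonoid.mem_comap] at hx ⊢
        simpa using hMn (q (ι g)) _ hx)
      (by
        intro a
        simpa using htot (q (ι a)))
    have i1 : CovariantClass (FreeGroup Y ⧸ T) (FreeGroup Y ⧸ T) (· * ·) (· ≤ ·) :=
      ⟨fun a b d h => hl b d a h⟩
    have i2 : CovariantClass (FreeGroup Y ⧸ T) (FreeGroup Y ⧸ T) (Function.swap (· * ·)) (· ≤ ·) :=
      ⟨fun a b d h => hr b d a h⟩
    have hnil : Subgroup.lowerCentralSeries (⊤ : Subgroup (FreeGroup Y ⧸ T)) c = ⊥ := by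
      have hs : Function.Surjective (QuotientGroup.mk' T) := QuotientGroup.mk'_surjective _
      rw [← Subgroup.map_top_of_surjective _ hs, ← Subgroup.map_lowerCentralSeries,
        Subgroup.map_eq_bot_iff, QuotientGroup.ker_mk']
      intro x hx
      have hx1 : q (ι x) = 1 := by
        have : (q.comp ι) x ∈ (Subgroup.lowerCentralSeries ⊤ c).map (q.comp ι) := ⟨x, hx, rfl⟩
        rw [Subgroup.map_lowerCentralSeries] at this
        have : (q.comp ι) x ∈ Subgroup.lowerCentralSeries (⊤ : Subgroup N) c :=
          Subgroup.lowerCentralSeries_mono c le_top this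
        rwa [hNil, Subgroup.mem_bot] at this
      apply hMT
      · rw [Submonoid.mem_comap]; simp [hx1, one_mem]
      · rw [Submonoid.mem_comap]; simp [hx1, one_mem]
    have hrep : ∀ x y : FreeGroup Y ⧸ T, 1 ≤ x ⊔ (y * x⁻¹ * y⁻¹) := by
      intro x y
      rcases le_total 1 x with h | h
      · exact h.trans le_sup_left
      · refine le_trans ?_ le_sup_right
        have h2 := hl _ _ x⁻¹ h
        rw [inv_mul_cancel, mul_one] at h2
        have h3 := hr _ _ y⁻¹ (hl _ _ y h2)
        simpa using h3
    have := H (FreeGroup Y ⧸ T) hnil hrep ((QuotientGroup.mk' T).comp ψ)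
    obtain ⟨i, -, hi⟩ := (Finset.le_sup'_iff _).mp this
    rw [MonoidHom.comp_apply, hpos, Submonoid.mem_comap] at hi
    simp only [MonoidHom.comp_apply, hψ] at hi
    exact hMS _ hi (Subsemigroup.subset_closure ⟨i, 1, by simp⟩)
end

section
/- Let λ be a rational number with λ > 1 and let S be a finite subset of G_λ. For s ∈ G_λ of the form x ↦ λⁿx + c, let s̃ : ℝ → ℝ be the affine map p ↦ λⁿp + c. Then the identity e of G_λ lies in S⁺ if and only if both sets ⋂_{s∈S} {p ∈ ℝ : s̃(p) < p} and ⋂_{s∈S} {p ∈ ℝ : s̃(p) > p} are empty. -/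
/-- The subring `ℤ[λ, λ⁻¹]` of `ℚ`. -/
def laurentRing (lam : ℚ) : Subring ℚ := Subring.closure {lam, lam⁻¹}

theorem zpow_mem_laurentRing (lam : ℚ) (n : ℤ) : lam ^ n ∈ laurentRing lam := by
  cases n with
  | ofNat k =>
      rw [show Int.ofNat k = (k : ℤ) from rfl, zpow_natCast]
      exact pow_mem (Subring.subset_closure (by simp)) k
  | negSucc k =>
      rw [zpow_negSucc, ← inv_pow]
      exact pow_mem (Subring.subset_closure (by simp)) (k + 1)

/-- The group `G_λ` of bijections of `ℚ` of the form `x ↦ λ^n x + c` with `n ∈ ℤ` and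
`c ∈ ℤ[λ, λ⁻¹]`, as a subgroup of the permutation group of `ℚ`. -/
def GLam (lam : ℚ) (hlam : 1 < lam) : Subgroup (Equiv.Perm ℚ) where
  carrier := {f : Equiv.Perm ℚ | ∃ n : ℤ, ∃ c ∈ laurentRing lam,
    ∀ x : ℚ, f x = lam ^ n * x + c}
  one_mem' := ⟨0, 0, Subring.zero_mem _, fun x => by simp⟩
  mul_mem' := by
    rintro f g ⟨n, c, hc, hf⟩ ⟨m, d, hd, hg⟩
    have hlam0 : lam ≠ 0 := ne_of_gt (lt_trans one_pos hlam)
    refine ⟨n + m, lam ^ n * d + c,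
      Subring.add_mem _ (Subring.mul_mem _ (zpow_mem_laurentRing lam n) hd) hc, fun x => ?_⟩
    have h1 : (f * g) x = f (g x) := rfl
    rw [h1, hg, hf, zpow_add₀ hlam0]
    ring
  inv_mem' := by
    rintro f ⟨n, c, hc, hf⟩
    have hlam0 : lam ≠ 0 := ne_of_gt (lt_trans one_pos hlam)
    have hmul : lam ^ n * lam ^ (-n) = 1 := by
      rw [← zpow_add₀ hlam0]; simp
    refine ⟨-n, -(lam ^ (-n) * c),
      Subring.neg_mem _ (Subring.mul_mem _ (zpow_mem_laurentRing lam (-n)) hc), fun x => ?_⟩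
    have key : f (lam ^ (-n) * x + -(lam ^ (-n) * c)) = x := by
      calc f (lam ^ (-n) * x + -(lam ^ (-n) * c))
          = lam ^ n * (lam ^ (-n) * x + -(lam ^ (-n) * c)) + c := hf _
        _ = (lam ^ n * lam ^ (-n)) * x - (lam ^ n * lam ^ (-n)) * c + c := by ring
        _ = x := by rw [hmul]; ring
    calc f⁻¹ x = f⁻¹ (f (lam ^ (-n) * x + -(lam ^ (-n) * c))) := by rw [key]
      _ = lam ^ (-n) * x + -(lam ^ (-n) * c) := Equiv.symm_apply_apply f _

def Cl (lam : ℚ) (P : ℤ → ℚ → Prop) : Prop :=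
  ∀ n c m d, P n c → P m d → P (n + m) (lam ^ n * d + c)

theorem Cl.pow {lam : ℚ} (hlam : 1 < lam) {P : ℤ → ℚ → Prop} (h : Cl lam P) {n : ℤ} {g : ℚ}
    (hg : P n (g * (1 - lam ^ n))) (k : ℕ) :
    P ((k + 1) * n) (g * (1 - lam ^ (((k : ℤ) + 1) * n))) := by
  have h0 : lam ≠ 0 := by linarith
  induction k with
  | zero => simpa using hg
  | succ k ih =>
    have := h _ _ _ _ ih hg
    convert this using 1
    · push_cast; ring
    · have : ((((k + 1 : ℕ) : ℤ) + 1) * n) = ((k : ℤ) + 1) * n + n := by push_cast; ring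
      rw [this, zpow_add₀ h0]
      ring

theorem Cl.trans {lam : ℚ} {P : ℤ → ℚ → Prop} (h : Cl lam P) {c : ℚ}
    (hg : P 0 c) (k : ℕ) : P 0 ((k + 1) * c) := by
  induction k with
  | zero => simpa using hg
  | succ k ih =>
    have := h _ _ _ _ ih hg
    convert this using 1
    push_cast; simp; ring

theorem Cl.trans' {lam : ℚ} {P : ℤ → ℚ → Prop} (h : Cl lam P) {c : ℚ}
    (hg : P 0 c) (k : ℕ) (hk : 0 < k) : P 0 (k * c) := by
  obtain ⟨j, rfl⟩ := Nat.exists_eq_succ_of_ne_zero hk.ne'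
  simpa using h.trans hg j

theorem Cl.zero {lam : ℚ} {P : ℤ → ℚ → Prop} (h : Cl lam P) {c d : ℚ}
    (hc : P 0 c) (hd : P 0 d) (h1 : 0 ≤ c) (h2 : d ≤ 0) : P 0 0 := by
  rcases h1.eq_or_lt with h1 | h1
  · rwa [← h1] at hc
  rcases h2.eq_or_lt with h2 | h2
  · rwa [h2] at hd
  obtain ⟨a, ha⟩ := Int.eq_ofNat_of_zero_le (Rat.num_pos.2 h1).le
  obtain ⟨b, hb⟩ := Int.eq_ofNat_of_zero_le (Rat.num_pos.2 (neg_pos.2 h2)).le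
  have ha0 : 0 < a := by have := Rat.num_pos.2 h1; omega
  have hb0 : 0 < b := by have := Rat.num_pos.2 (neg_pos.2 h2); omega
  have e1 : c * c.den = a := by
    rw [Rat.mul_den_eq_num, ha]; simp
  have e2 : (-d) * (-d).den = b := by
    rw [Rat.mul_den_eq_num, hb]; simp
  have := h _ _ _ _ (h.trans' hc (b * c.den) (Nat.mul_pos hb0 c.den_pos))
    (h.trans' hd (a * (-d).den) (Nat.mul_pos ha0 (-d).den_pos))
  convert this using 1
  push_cast
  rw [Nat.cast_mul, Nat.cast_mul, zpow_zero]
  linear_combination (-(b : ℚ)) * e1 + a * e2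

theorem Cl.nonneg {lam : ℚ} (hlam : 1 < lam) {P : ℤ → ℚ → Prop} (h : Cl lam P)
    (T : Set (ℤ × ℚ)) (hT : T.Finite) (hTP : ∀ t ∈ T, P t.1 t.2)
    (hp : ¬ ∃ p : ℚ, ∀ t ∈ T, lam ^ t.1 * p + t.2 < p) : ∃ c, 0 ≤ c ∧ P 0 c := by
  classical
  by_contra hcon
  push Not at hcon
  apply hp
  have h0 : lam ≠ 0 := by linarith
  let φ : ℤ × ℚ → ℚ := fun t => t.2 / (1 - lam ^ t.1)
  let A := hT.toFinset.filter (fun t => t.1 < 0)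
  let B := hT.toFinset.filter (fun t => 0 < t.1)
  have key : ∀ x ∈ A.image φ, ∀ y ∈ B.image φ, x < y := by
    intro x hx y hy
    simp only [A, B, Finset.mem_image, Finset.mem_filter, Set.Finite.mem_toFinset] at hx hy
    obtain ⟨⟨m, d⟩, ⟨hmT, hm⟩, rfl⟩ := hx
    obtain ⟨⟨n, c⟩, ⟨hnT, hn⟩, rfl⟩ := hy
    by_contra hle
    push Not at hle
    simp only at hm hn
    have hm1 : lam ^ m < 1 := zpow_lt_one_of_neg₀ hlam hm
    have hn1 : 1 < lam ^ n := one_lt_zpow₀ hlam hn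
    have e1 : φ (m, d) * (1 - lam ^ m) = d := div_mul_cancel₀ _ (by linarith)
    have e2 : φ (n, c) * (1 - lam ^ n) = c := div_mul_cancel₀ _ (by linarith)
    have p1 := hTP _ hmT
    have p2 := hTP _ hnT
    simp only at p1 p2
    rw [← e1] at p1
    rw [← e2] at p2
    generalize φ (m, d) = f at *
    generalize φ (n, c) = g at *
    obtain ⟨j, hj⟩ : ∃ j : ℕ, n = j + 1 := ⟨(n - 1).toNat, by omega⟩
    obtain ⟨i, hi⟩ : ∃ i : ℕ, m = -(i + 1) := ⟨(-m - 1).toNat, by omega⟩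
    have q1 := h.pow hlam p1 j
    have q2 := h.pow hlam p2 i
    rw [← hj] at q1
    rw [show (i : ℤ) + 1 = -m by omega] at q2
    have q := h _ _ _ _ q2 q1
    rw [show -m * n + n * m = 0 by ring] at q
    refine hcon _ ?_ q
    have hpos : 0 < -m * n := mul_pos (by omega) hn
    have hk : 1 < lam ^ (-m * n) := one_lt_zpow₀ hlam hpos
    have hinv : lam ^ (-m * n) * lam ^ (n * m) = 1 := by
      rw [← zpow_add₀ h0, show -m * n + n * m = 0 by ring, zpow_zero]
    have : lam ^ (-m * n) * (f * (1 - lam ^ (n * m))) + g * (1 - lam ^ (-m * n))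
      = (lam ^ (-m * n) - 1) * (f - g) := by linear_combination (-f) * hinv
    rw [this]
    exact mul_nonneg (by linarith) (by linarith)
  obtain ⟨p, hp1, hp2⟩ := Order.exists_between_finsets _ _ key
  refine ⟨p, ?_⟩
  rintro ⟨n, c⟩ ht
  simp only
  rcases lt_trichotomy n 0 with hn | hn | hn
  · have := hp1 (φ (n, c)) (Finset.mem_image_of_mem _ (by simp [A, ht, hn]))
    have hn1 : lam ^ n < 1 := zpow_lt_one_of_neg₀ hlam hn
    have h2 : c < p * (1 - lam ^ n) := (div_lt_iff₀ (by linarith)).1 this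
    linarith
  · subst hn
    have : ¬ 0 ≤ c := fun hc => hcon c hc (hTP _ ht)
    simp; linarith
  · have := hp2 (φ (n, c)) (Finset.mem_image_of_mem _ (by simp [B, ht, hn]))
    have hn1 : 1 < lam ^ n := one_lt_zpow₀ hlam hn
    have h2 : c < p * (1 - lam ^ n) := (lt_div_iff_of_neg (by linarith)).1 this
    linarith

theorem rep_unique {lam : ℚ} (hlam : 1 < lam) {n m : ℤ} {c d : ℚ}
    (h : ∀ x : ℚ, lam ^ n * x + c = lam ^ m * x + d) : n = m ∧ c = d := by
  have h0 := h 0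
  have h1 := h 1
  simp only [mul_zero, zero_add, mul_one] at h0 h1
  subst h0
  exact ⟨zpow_right_injective₀ (by linarith) hlam.ne' (by simpa using h1), rfl⟩

theorem fwd {lam : ℚ} (hlam : 1 < lam) (S : Set ↥(GLam lam hlam)) (R : ℝ → ℝ → Prop)
    (htr : ∀ a b c, R a b → R b c → R a c)
    (haf : ∀ k a b c, 0 < k → R a b → R (k * a + c) (k * b + c)) (hirr : ∀ a, ¬ R a a)
    (h1 : (1 : ↥(GLam lam hlam)) ∈ Subsemigroup.closure S) :
    {p : ℝ | ∀ s ∈ S, ∀ (n : ℤ) (c : ℚ),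
          (∀ x : ℚ, (s : Equiv.Perm ℚ) x = lam ^ n * x + c) →
            R ((lam : ℝ) ^ n * p + (c : ℝ)) p} = ∅ := by
  rw [Set.eq_empty_iff_forall_notMem]
  intro p hp
  have hl0 : (0 : ℝ) < lam := by exact_mod_cast (by linarith : (0 : ℚ) < lam)
  have key : ∀ s ∈ Subsemigroup.closure S, ∃ (n : ℤ) (c : ℚ),
      (∀ x : ℚ, (s : Equiv.Perm ℚ) x = lam ^ n * x + c) ∧ R ((lam : ℝ) ^ n * p + (c : ℝ)) p := by
    intro s hs
    induction hs using Subsemigroup.closure_induction with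
    | mem s hs =>
      obtain ⟨n, c, -, h⟩ := s.2
      exact ⟨n, c, h, hp s hs n c h⟩
    | mul s t _ _ ihs iht =>
      obtain ⟨n, c, h, hr⟩ := ihs
      obtain ⟨m, d, h', hr'⟩ := iht
      refine ⟨n + m, lam ^ n * d + c, fun x => ?_, ?_⟩
      · have : ((s * t : ↥(GLam lam hlam)) : Equiv.Perm ℚ) x
          = (s : Equiv.Perm ℚ) ((t : Equiv.Perm ℚ) x) := rfl
        rw [this, h', h, zpow_add₀ (by linarith)]
        ring
      · refine htr _ _ _ ?_ hr
        convert haf ((lam : ℝ) ^ n) _ _ (c : ℝ) (zpow_pos hl0 n) hr' using 1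
        push_cast
        rw [zpow_add₀ hl0.ne']
        ring
  obtain ⟨n, c, h, hr⟩ := key 1 h1
  obtain ⟨rfl, rfl⟩ := rep_unique hlam (n := n) (m := 0) (c := c) (d := 0)
    (fun x => by rw [← h x]; simp)
  simp at hr
  exact hirr _ hr

theorem stmt16 (lam : ℚ) (hlam : 1 < lam) (S : Set ↥(GLam lam hlam)) (hS : S.Finite) :
    (1 : ↥(GLam lam hlam)) ∈ Subsemigroup.closure S ↔
      ({p : ℝ | ∀ s ∈ S, ∀ (n : ℤ) (c : ℚ),
          (∀ x : ℚ, (s : Equiv.Perm ℚ) x = lam ^ n * x + c) →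
            (lam : ℝ) ^ n * p + (c : ℝ) < p} = ∅ ∧
        {p : ℝ | ∀ s ∈ S, ∀ (n : ℤ) (c : ℚ),
          (∀ x : ℚ, (s : Equiv.Perm ℚ) x = lam ^ n * x + c) →
            (lam : ℝ) ^ n * p + (c : ℝ) > p} = ∅) := by
  constructor
  · intro h1
    refine ⟨fwd hlam S (fun a b => a < b) (fun a b c => lt_trans) ?_ (fun a => lt_irrefl a) h1,
      fwd hlam S (fun a b => a > b) (fun a b c => gt_trans) ?_ (fun a => lt_irrefl a) h1⟩
    · intro k a b c hk h
      have := mul_lt_mul_of_pos_left h hk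
      linarith
    · intro k a b c hk h
      have := mul_lt_mul_of_pos_left h hk
      simp only [gt_iff_lt]; linarith
  · rintro ⟨hlt, hgt⟩
    let P : ℤ → ℚ → Prop := fun n c => ∃ s ∈ Subsemigroup.closure S,
      ∀ x : ℚ, (s : Equiv.Perm ℚ) x = lam ^ n * x + c
    have hP : Cl lam P := by
      rintro n c m d ⟨s, hs, h⟩ ⟨t, ht, h'⟩
      refine ⟨s * t, mul_mem hs ht, fun x => ?_⟩
      have : ((s * t : ↥(GLam lam hlam)) : Equiv.Perm ℚ) x
        = (s : Equiv.Perm ℚ) ((t : Equiv.Perm ℚ) x) := rfl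
      rw [this, h', h, zpow_add₀ (by linarith)]
      ring
    have hP' : Cl lam (fun n c => P n (-c)) := by
      intro n c m d h h'
      have := hP _ _ _ _ h h'
      show P _ _
      convert this using 1
      ring
    have hex : ∀ s : ↥(GLam lam hlam), ∃ t : ℤ × ℚ,
        ∀ x : ℚ, (s : Equiv.Perm ℚ) x = lam ^ t.1 * x + t.2 := by
      intro s
      obtain ⟨n, c, -, h⟩ := s.2
      exact ⟨(n, c), h⟩
    choose τ hτ using hex
    obtain ⟨c, hc, hPc⟩ := hP.nonneg hlam (τ '' S) (hS.image _) (by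
      rintro _ ⟨s, hs, rfl⟩
      exact ⟨s, Subsemigroup.subset_closure hs, hτ s⟩) (by
      rintro ⟨p, hp⟩
      refine Set.eq_empty_iff_forall_notMem.1 hlt (p : ℝ) ?_
      intro s hs n c h
      obtain ⟨h1, h2⟩ := rep_unique hlam (fun x => (hτ s x).symm.trans (h x))
      have := hp _ ⟨s, hs, rfl⟩
      rw [h1, h2] at this
      exact_mod_cast this)
    obtain ⟨d, hd, hPd⟩ := hP'.nonneg hlam ((fun s => ((τ s).1, -(τ s).2)) '' S) (hS.image _) (by
      rintro _ ⟨s, hs, rfl⟩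
      refine ⟨s, Subsemigroup.subset_closure hs, ?_⟩
      simpa using hτ s) (by
      rintro ⟨p, hp⟩
      refine Set.eq_empty_iff_forall_notMem.1 hgt ((-p : ℚ) : ℝ) ?_
      intro s hs n c h
      obtain ⟨h1, h2⟩ := rep_unique hlam (fun x => (hτ s x).symm.trans (h x))
      have := hp _ ⟨s, hs, rfl⟩
      simp only at this
      rw [h1, h2] at this
      have h3 : lam ^ n * (-p) + c > -p := by linarith
      exact_mod_cast h3)
    obtain ⟨s, hs, h⟩ := hP.zero hPc hPd hc (by linarith)
    have : s = 1 := by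
      apply Subtype.ext
      apply Equiv.ext
      intro x
      rw [h]; simp
    rwa [this] at hs
end

section
/- Let G be a group. The following conditions are equivalent: (1) G is fully left-orderable; (2) every finitely generated subgroup of G is fully left-orderable; (3) for every finite subset S of G, if the identity e is not in S⁺, then S⁺ is contained in a positive cone of a left-order on G. -/
/-- A positive cone of a left-order on `G`: a subsemigroup `P` such that for every `g`
exactly one of `g ∈ P`, `g = 1`, `g⁻¹ ∈ P` holds. -/
def IsLeftOrderCone {G : Type*} [Group G] (P : Subsemigroup G) : Prop :=
  (∀ g : G, g ∈ P ∨ g = 1 ∨ g⁻¹ ∈ P) ∧ (1 : G) ∉ P ∧ ∀ g : G, g ∈ P → g⁻¹ ∉ P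

/-- `G` is fully left-orderable: every subsemigroup not containing the identity is contained in
a positive cone of a left-order. -/
def FullyLeftOrderable (G : Type*) [Group G] : Prop :=
  ∀ Q : Subsemigroup G, (1 : G) ∉ Q → ∃ P : Subsemigroup G, IsLeftOrderCone P ∧ Q ≤ P

theorem fin_closure {G : Type*} [Group G] (T : Set G) (x : G)
    (hx : x ∈ Subsemigroup.closure T) :
    ∃ S : Set G, S.Finite ∧ S ⊆ T ∧ x ∈ Subsemigroup.closure S := by
  induction hx using Subsemigroup.closure_induction with
  | mem x hx =>
    exact ⟨{x}, Set.finite_singleton x, by simpa using hx, Subsemigroup.subset_closure rfl⟩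
  | mul x y _ _ hx hy =>
    obtain ⟨S, hS, hST, h1⟩ := hx
    obtain ⟨S', hS', hST', h2⟩ := hy
    exact ⟨S ∪ S', hS.union hS', Set.union_subset hST hST',
      mul_mem (Subsemigroup.closure_mono Set.subset_union_left h1)
        (Subsemigroup.closure_mono Set.subset_union_right h2)⟩

def StarProp (G : Type*) [Group G] : Prop :=
  ∀ S : Set G, S.Finite → (1 : G) ∉ Subsemigroup.closure S → ∀ g : G, g ≠ 1 →
    (1 : G) ∉ Subsemigroup.closure (insert g S) ∨ (1 : G) ∉ Subsemigroup.closure (insert g⁻¹ S)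

theorem flo_of_star {G : Type*} [Group G] (h : StarProp G) : FullyLeftOrderable G := by
  intro Q hQ
  obtain ⟨P, hQP, hP⟩ := zorn_le_nonempty₀ {P : Subsemigroup G | (1 : G) ∉ P} (by
    intro c hc hch y hy
    refine ⟨sSup c, ?_, fun z hz => le_sSup hz⟩
    intro h1
    rw [Subsemigroup.mem_sSup_of_directed_on hch.directedOn] at h1
    obtain ⟨s, hs, h1⟩ := h1
    exact hc hs h1) Q hQ
  have h1P : (1 : G) ∉ P := hP.prop
  refine ⟨P, ⟨?_, h1P, fun g hg hg' => h1P (by simpa using mul_mem hg hg')⟩, hQP⟩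
  have key : ∀ g : G, g ∉ P → ∃ S : Set G, S.Finite ∧ S ⊆ P ∧
      (1 : G) ∈ Subsemigroup.closure (insert g S) := by
    intro g hg
    have h1 : (1 : G) ∈ Subsemigroup.closure (insert g (P : Set G)) := by
      by_contra hn
      have hle : P ≤ Subsemigroup.closure (insert g (P : Set G)) := fun x hx =>
        Subsemigroup.subset_closure (Set.mem_insert_of_mem _ hx)
      exact hg (hP.le_of_ge hn hle (Subsemigroup.subset_closure (Set.mem_insert _ _)))
    obtain ⟨S, hS, hST, h1⟩ := fin_closure _ _ h1
    refine ⟨S \ {g}, hS.subset Set.sdiff_subset, ?_, ?_⟩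
    · rintro x ⟨hx, hxg⟩
      exact (hST hx).resolve_left hxg
    · refine Subsemigroup.closure_mono ?_ h1
      intro x hx
      by_cases hxg : x = g
      · exact Or.inl hxg
      · exact Or.inr ⟨hx, hxg⟩
  intro g
  by_contra! hc
  obtain ⟨hg, hg1, hg'⟩ := hc
  obtain ⟨S, hS, hSP, h1⟩ := key g hg
  obtain ⟨S', hS', hSP', h1'⟩ := key _ hg'
  have hU : (1 : G) ∉ Subsemigroup.closure (S ∪ S') := fun hu =>
    h1P ((Subsemigroup.closure_le.2 (Set.union_subset hSP hSP')) hu)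
  rcases h _ (hS.union hS') hU g hg1 with h2 | h2
  · exact h2 (Subsemigroup.closure_mono (Set.insert_subset_insert Set.subset_union_left) h1)
  · exact h2 (Subsemigroup.closure_mono (Set.insert_subset_insert Set.subset_union_right) h1')

theorem flo_subgroup {G : Type*} [Group G] (h : FullyLeftOrderable G) (H : Subgroup G) :
    FullyLeftOrderable ↥H := by
  intro Q hQ
  obtain ⟨P, ⟨hP1, hP2, hP3⟩, hQP⟩ := h (Q.map (H.subtype : ↥H →ₙ* G)) (by
    rintro ⟨x, hx, hx1⟩
    have : x = 1 := Subtype.ext hx1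
    exact hQ (this ▸ hx))
  refine ⟨P.comap (H.subtype : ↥H →ₙ* G), ⟨?_, ?_, ?_⟩, ?_⟩
  · intro g
    rcases hP1 (g : G) with h | h | h
    · exact Or.inl h
    · exact Or.inr (Or.inl (Subtype.ext h))
    · exact Or.inr (Or.inr h)
  · exact hP2
  · intro g hg
    exact hP3 (g : G) hg
  · intro x hx
    exact hQP ⟨x, hx, rfl⟩

theorem star_of_fg {G : Type*} [Group G]
    (h : ∀ H : Subgroup G, H.FG → FullyLeftOrderable ↥H) : StarProp G := by
  intro S hS h1 g hg
  let H := Subgroup.closure (insert g S)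
  have hsub : insert g S ⊆ (H : Set G) := Subgroup.subset_closure
  have hgH : g ∈ H := hsub (Set.mem_insert _ _)
  obtain ⟨P, ⟨hP1, hP2, hP3⟩, hQP⟩ := h H
    ((Subgroup.fg_iff _).2 ⟨_, rfl, hS.insert g⟩)
    ((Subsemigroup.closure S).comap (H.subtype : ↥H →ₙ* G)) h1
  have h1M : (1 : G) ∉ P.map (H.subtype : ↥H →ₙ* G) := by
    rintro ⟨x, hx, hx1⟩
    have : x = 1 := Subtype.ext hx1
    exact hP2 (this ▸ hx)
  have hSM : S ⊆ P.map (H.subtype : ↥H →ₙ* G) := fun x hx =>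
    ⟨⟨x, hsub (Set.mem_insert_of_mem _ hx)⟩, hQP (Subsemigroup.subset_closure hx), rfl⟩
  rcases hP1 ⟨g, hgH⟩ with h2 | h2 | h2
  · left
    exact fun hc => h1M (Subsemigroup.closure_le.2 (Set.insert_subset (Subsemigroup.mem_map_of_mem _ h2) hSM) hc)
  · exact absurd (congrArg Subtype.val h2) hg
  · right
    exact fun hc => h1M (Subsemigroup.closure_le.2 (Set.insert_subset (Subsemigroup.mem_map_of_mem _ h2) hSM) hc)

theorem star_of_fin {G : Type*} [Group G]
    (h : ∀ S : Set G, S.Finite → (1 : G) ∉ Subsemigroup.closure S →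
      ∃ P : Subsemigroup G, IsLeftOrderCone P ∧ Subsemigroup.closure S ≤ P) : StarProp G := by
  intro S hS h1 g hg
  obtain ⟨P, ⟨hP1, hP2, hP3⟩, hQP⟩ := h S hS h1
  have hSP : S ⊆ P := Subsemigroup.closure_le.1 hQP
  rcases hP1 g with h2 | h2 | h2
  · exact Or.inl fun hc => hP2 (Subsemigroup.closure_le.2 (Set.insert_subset h2 hSP) hc)
  · exact absurd h2 hg
  · exact Or.inr fun hc => hP2 (Subsemigroup.closure_le.2 (Set.insert_subset h2 hSP) hc)

theorem stmt18 {G : Type*} [Group G] :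
    (FullyLeftOrderable G ↔ ∀ H : Subgroup G, H.FG → FullyLeftOrderable ↥H) ∧
    (FullyLeftOrderable G ↔ ∀ S : Set G, S.Finite → (1 : G) ∉ Subsemigroup.closure S →
      ∃ P : Subsemigroup G, IsLeftOrderCone P ∧ Subsemigroup.closure S ≤ P) := by
  exact ⟨⟨fun h H _ => flo_subgroup h H, fun h => flo_of_star (star_of_fg h)⟩,
    ⟨fun h S _ h1 => h _ h1, fun h => flo_of_star (star_of_fin h)⟩⟩
end
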